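/- Let Ω ⊆ ℂ be a Denjoy domain with Ω ∩ ℝ = ⋃_{n≥0} (a_n, b_n), and let κ_Ω denote either the Poincaré metric h_Ω or the quasihyperbolic metric k_Ω. If there exist a constant C and a sequence of fundamental geodesics {γ_n}_{n≥1} (for κ_Ω) with κ_Ω-length ℓ_{κ_Ω}(γ_n) ≤ C for every n, then κ_Ω is Gromov δ-hyperbolic, where δ depends only on C. -/

import Mathlib

open Set Metric Filter Complex

noncomputable section

/-- The length of a curve `γ : [0,1] → E` with respect to the conformal density `ρ`. -/
def curveLen {E : Type*} [NormedAddCommGroup E] [NormedSpace ℝ E]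
    (ρ : E → ℝ) (γ : ℝ → E) : ℝ :=
  ∫ t in (0:ℝ)..1, ρ (γ t) * ‖deriv γ t‖

/-- The distance induced on the set `S` by the conformal density `ρ`, defined as the infimum
of the `ρ`-lengths of C¹ curves joining the two points inside `S`. -/
def densityDist {E : Type*} [NormedAddCommGroup E] [NormedSpace ℝ E]
    (S : Set E) (ρ : E → ℝ) (z w : E) : ℝ :=
  sInf { L | ∃ γ : ℝ → E, ContDiffOn ℝ 1 γ (Icc 0 1) ∧ γ 0 = z ∧ γ 1 = w ∧
      (∀ t ∈ Icc (0:ℝ) 1, γ t ∈ S) ∧ L = curveLen ρ γ }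

/-- The quasihyperbolic density `1/δ_Ω(z)` of a domain `Ω`. -/
def qhDensity {E : Type*} [NormedAddCommGroup E] [NormedSpace ℝ E] (Ω : Set E) : E → ℝ :=
  fun z => (Metric.infDist z Ωᶜ)⁻¹

/-- The quasihyperbolic distance of a domain `Ω`. -/
def qhDist {E : Type*} [NormedAddCommGroup E] [NormedSpace ℝ E] (Ω : Set E) : E → E → ℝ :=
  densityDist Ω (qhDensity Ω)

/-- `lam` is the density of the Poincaré (hyperbolic) metric of the plane domain `Ω`:
it is the pushforward of the density `2/(1-|z|²)` of the unit disk under a holomorphic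
universal covering map `p : 𝔻 → Ω`. -/
def IsPoincareDensity (Ω : Set ℂ) (lam : ℂ → ℝ) : Prop :=
  ∃ p : ℂ → ℂ,
    (∀ z ∈ ball (0:ℂ) 1, DifferentiableAt ℂ p z) ∧
    p '' ball (0:ℂ) 1 = Ω ∧
    IsCoveringMapOn (fun z : ball (0:ℂ) 1 => p z) Ω ∧
    ∀ z ∈ ball (0:ℂ) 1, lam (p z) * ‖deriv p z‖ = 2 / (1 - ‖z‖ ^ 2)

/-- `g` is a geodesic in `(S, d)` from `x` to `y`, parametrized by arclength on
`[0, d x y]`. -/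
def IsGeodesicIn {α : Type*} (S : Set α) (d : α → α → ℝ) (g : ℝ → α) (x y : α) : Prop :=
  g 0 = x ∧ g (d x y) = y ∧ (∀ t ∈ Icc (0:ℝ) (d x y), g t ∈ S) ∧
  ∀ s ∈ Icc (0:ℝ) (d x y), ∀ t ∈ Icc (0:ℝ) (d x y), d (g s) (g t) = |s - t|

/-- Every geodesic triangle of `(S, d)` is `δ`-thin (Rips condition). -/
def GromovHyperbolicWith {α : Type*} (S : Set α) (d : α → α → ℝ) (δ : ℝ) : Prop :=
  ∀ x ∈ S, ∀ y ∈ S, ∀ z ∈ S, ∀ gxy gxz gzy : ℝ → α,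
    IsGeodesicIn S d gxy x y → IsGeodesicIn S d gxz x z → IsGeodesicIn S d gzy z y →
    ∀ t ∈ Icc (0:ℝ) (d x y),
      ∃ p ∈ gxz '' Icc (0:ℝ) (d x z) ∪ gzy '' Icc (0:ℝ) (d z y), d (gxy t) p ≤ δ

/-- `(S, d)` is Gromov hyperbolic: some `δ ≥ 0` works for all geodesic triangles. -/
def IsGromovHyperbolic {α : Type*} (S : Set α) (d : α → α → ℝ) : Prop :=
  ∃ δ : ℝ, 0 ≤ δ ∧ GromovHyperbolicWith S d δ

/-- The real axis inside `ℂ`. -/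
def realLine : Set ℂ := {z : ℂ | z.im = 0}

/-- A Denjoy domain: a domain whose boundary is contained in the real axis. -/
def IsDenjoyDomain (Ω : Set ℂ) : Prop :=
  IsOpen Ω ∧ IsConnected Ω ∧ frontier Ω ⊆ realLine

/-- The distance (for the distance function `d`) from a point to a set. -/
def distToSet {α : Type*} (d : α → α → ℝ) (z : α) (A : Set α) : ℝ :=
  sInf (d z '' A)

/-- A fundamental geodesic: a geodesic of `(S, d)` contained in the closed upper half plane,
joining a point of the boundary interval `I` (on the real axis) to a point of the boundary
interval `J`. -/
def IsFundGeodesic (S : Set ℂ) (d : ℂ → ℂ → ℝ) (I J : Set ℝ) (g : ℝ → ℂ) (x y : ℂ) : Prop :=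
  IsGeodesicIn S d g x y ∧ x.im = 0 ∧ x.re ∈ I ∧ y.im = 0 ∧ y.re ∈ J ∧
  ∀ t ∈ Icc (0:ℝ) (d x y), 0 ≤ (g t).im

end

section FourPoint

variable {α : Type*} {S X A : Set α} {d : α → α → ℝ}

/-- The restriction of `d` to `S` satisfies the laws of a pseudometric. -/
structure IsPseudoDistOn (S : Set α) (d : α → α → ℝ) : Prop where
  nonneg : ∀ x ∈ S, ∀ y ∈ S, 0 ≤ d x y
  self : ∀ x ∈ S, d x x = 0
  symm : ∀ x ∈ S, ∀ y ∈ S, d x y = d y x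
  triangle : ∀ x ∈ S, ∀ y ∈ S, ∀ z ∈ S, d x z ≤ d x y + d y z

theorem IsPseudoDistOn.mono (h : IsPseudoDistOn S d) (hXS : X ⊆ S) : IsPseudoDistOn X d where
  nonneg x hx y hy := h.nonneg x (hXS hx) y (hXS hy)
  self x hx := h.self x (hXS hx)
  symm x hx y hy := h.symm x (hXS hx) y (hXS hy)
  triangle x hx y hy z hz := h.triangle x (hXS hx) y (hXS hy) z (hXS hz)

/-- Gromov's four point condition. -/
def FourPoint (S : Set α) (d : α → α → ℝ) (δ : ℝ) : Prop :=
  ∀ x ∈ S, ∀ y ∈ S, ∀ z ∈ S, ∀ w ∈ S, d x z + d y w ≤ max (d x y + d z w) (d x w + d y z) + δ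

theorem FourPoint.gromovHyperbolicWith (hd : IsPseudoDistOn S d) {δ : ℝ}
    (hδ : 0 ≤ δ) (h : FourPoint S d δ) : GromovHyperbolicWith S d (2 * δ) := by
  have key : ∀ x ∈ S, ∀ z ∈ S, ∀ p ∈ S, ∀ g : ℝ → α, IsGeodesicIn S d g x z →
      d x p + d p z ≤ d x z + δ → ∃ q ∈ g '' Icc (0:ℝ) (d x z), d p q ≤ 2 * δ := by
    rintro x hx z hz p hp g ⟨g0, g1, gS, gd⟩ hle
    have hxz := hd.nonneg x hx z hz
    have hxp := hd.nonneg x hx p hp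
    have hu : min (d x p) (d x z) ∈ Icc 0 (d x z) := ⟨le_min hxp hxz, min_le_right _ _⟩
    set u := min (d x p) (d x z) with hu_def
    refine ⟨g u, mem_image_of_mem g hu, ?_⟩
    have e1 : d x (g u) = u := by
      rw [← g0, gd 0 ⟨le_rfl, hxz⟩ u hu, zero_sub, abs_neg, abs_of_nonneg hu.1]
    have e2 : d (g u) z = d x z - u := by
      have := gd u hu (d x z) ⟨hxz, le_rfl⟩
      rw [g1] at this
      rw [this, abs_sub_comm, abs_of_nonneg (by linarith [hu.2])]
    have h4 := h p hp x hx (g u) (gS u hu) z hz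
    have hs := hd.symm p hp x hx
    have hpz := hd.nonneg p hp z hz
    rcases min_choice (d x p) (d x z) with h1 | h1 <;>
    rcases max_choice (d p x + d (g u) z) (d p z + d x (g u)) with h2 | h2 <;>
    rw [h2] at h4 <;> rw [← hu_def] at h1 <;> linarith [hu.2, min_le_left (d x p) (d x z)]
  rintro x hx y hy z hz gxy gxz gzy ⟨g0, g1, gS, gd⟩ hxz hzy t ht
  have hxy := hd.nonneg x hx y hy
  have hp := gS t ht
  have e1 : d x (gxy t) = t := by
    rw [← g0, gd 0 ⟨le_rfl, hxy⟩ t ht, zero_sub, abs_neg, abs_of_nonneg ht.1]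
  have e2 : d (gxy t) y = d x y - t := by
    have := gd t ht (d x y) ⟨hxy, le_rfl⟩
    rw [g1] at this
    rw [this, abs_sub_comm, abs_of_nonneg (by linarith [ht.2])]
  have h4 := h x hx z hz y hy _ hp
  have hs1 := hd.symm z hz _ hp
  have hs2 := hd.symm y hy _ hp
  rcases max_choice (d x z + d y (gxy t)) (d x (gxy t) + d z y) with h2 | h2 <;> rw [h2] at h4
  · obtain ⟨q, hq, hq'⟩ := key x hx z hz _ hp gxz hxz (by linarith)
    exact ⟨q, Or.inl hq, hq'⟩
  · obtain ⟨q, hq, hq'⟩ := key z hz y hy _ hp gzy hzy (by linarith)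
    exact ⟨q, Or.inr hq, hq'⟩

/-- The points `p` and `q` are joined by a rough geodesic whose points lie in `A`. -/
def RoughlyJoined (A : Set α) (d : α → α → ℝ) (K : ℝ) (p q : α) : Prop :=
  ∀ t, 0 ≤ t → t ≤ d p q → ∃ m ∈ A, d p m ≤ t + K ∧ d m q ≤ d p q - t + K

theorem RoughlyJoined.mono {K K' : ℝ} {p q : α} (h : RoughlyJoined A d K p q) (hK : K ≤ K') :
    RoughlyJoined A d K' p q := by
  intro t h0 h1
  obtain ⟨m, hm, h2, h3⟩ := h t h0 h1
  exact ⟨m, hm, by linarith, by linarith⟩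

theorem RoughlyJoined.symm (hd : IsPseudoDistOn A d) {K : ℝ} {p q : α}
    (hp : p ∈ A) (hq : q ∈ A) (h : RoughlyJoined A d K p q) : RoughlyJoined A d K q p := by
  intro t h0 h1
  have e := hd.symm p hp q hq
  obtain ⟨m, hm, h2, h3⟩ := h (d p q - t) (by linarith) (by linarith)
  exact ⟨m, hm, by linarith [hd.symm m hm q hq], by linarith [hd.symm m hm p hp]⟩

theorem roughlyJoined_of_dist_le (hd : IsPseudoDistOn A d) {K : ℝ} {p q : α}
    (hp : p ∈ A) (hK : d p q ≤ K) : RoughlyJoined A d K p q := by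
  intro t h0 h1
  exact ⟨p, hp, by linarith [hd.self p hp], by linarith⟩

theorem RoughlyJoined.trans (hd : IsPseudoDistOn A d) {δ K : ℝ} (hδ : 0 ≤ δ)
    (h4 : FourPoint A d δ) {p v q : α} (hp : p ∈ A) (hv : v ∈ A) (hq : q ∈ A)
    (h1 : RoughlyJoined A d K p v) (h2 : RoughlyJoined A d K v q) :
    RoughlyJoined A d (K + δ) p q := by
  intro t h0 ht
  have t1 := hd.triangle p hp v hv q hq
  have t2 := hd.triangle v hv p hp q hq
  have t3 := hd.triangle p hp q hq v hv
  have s1 := hd.symm p hp v hv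
  have s2 := hd.symm v hv q hq
  rcases le_total (2 * t) (d p v + d p q - d v q) with hg | hg
  · obtain ⟨m, hm, a, b⟩ := h1 t h0 (by linarith)
    refine ⟨m, hm, by linarith, ?_⟩
    have := h4 m hm p hp q hq v hv
    have s3 := hd.symm p hp m hm
    rcases max_choice (d m p + d q v) (d m v + d p q) with h | h <;> rw [h] at this <;> linarith
  · obtain ⟨m, hm, a, b⟩ := h2 (d v q - (d p q - t)) (by linarith) (by linarith)
    refine ⟨m, hm, ?_, by linarith⟩
    have := h4 m hm v hv p hp q hq
    have s3 := hd.symm p hp m hm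
    have s4 := hd.symm v hv m hm
    rcases max_choice (d m v + d p q) (d m q + d v p) with h | h <;> rw [h] at this <;> linarith

/-- Nearest point projection onto a rough geodesic subset. -/
theorem FourPoint.exists_projection (hd : IsPseudoDistOn X d) {δ K : ℝ} (hδ : 0 ≤ δ)
    (hK : 0 ≤ K) (h4 : FourPoint X d δ) (hAX : A ⊆ X) (hA : A.Nonempty)
    (hj : ∀ p ∈ A, ∀ q ∈ A, RoughlyJoined A d K p q) {x : α} (hx : x ∈ X) :
    ∃ a ∈ A, ∀ q ∈ A, d x a + d a q ≤ d x q + (2 * K + 2 * δ + 3) := by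
  have hbdd : BddBelow (d x '' A) :=
    ⟨0, by rintro _ ⟨q, hq, rfl⟩; exact hd.nonneg x hx q (hAX hq)⟩
  obtain ⟨_, ⟨a, ha, rfl⟩, hlt⟩ := exists_lt_of_csInf_lt (hA.image (d x))
    (lt_add_one (sInf (d x '' A)))
  have hmin : ∀ q ∈ A, d x a ≤ d x q + 1 := fun q hq =>
    hlt.le.trans (by linarith [csInf_le hbdd (mem_image_of_mem (d x) hq)])
  refine ⟨a, ha, fun q hq => ?_⟩
  rcases lt_or_ge (d a q) (K + δ + 2) with h | h
  · linarith [hmin q hq]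
  · obtain ⟨m, hm, h1, h2⟩ := hj a ha q hq (K + δ + 2) (by linarith) h
    have := h4 x hx a (hAX ha) m (hAX hm) q (hAX hq)
    have := hmin m hm
    rcases max_choice (d x a + d m q) (d x q + d a m) with h | h <;> linarith

/-- Doubling a space satisfying the four point condition along a rough geodesic subset. -/
theorem FourPoint.double (hd : IsPseudoDistOn S d) {σ : α → α} (hσS : ∀ x ∈ S, σ x ∈ S)
    (hσd : ∀ x ∈ S, ∀ y ∈ S, d (σ x) (σ y) = d x y)
    (hσσ : ∀ x ∈ S, σ (σ x) = x) (hXS : X ⊆ S) (hAX : A ⊆ X) (hσA : ∀ a ∈ A, σ a = a)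
    (hcover : ∀ x ∈ S, x ∈ X ∨ σ x ∈ X)
    (hcross : ∀ x ∈ X, ∀ y ∈ X, ∃ q ∈ A, d x q + d q (σ y) ≤ d x (σ y) + 1)
    {δ K : ℝ} (hδ : 0 ≤ δ) (hK : 0 ≤ K) (h4 : FourPoint X d δ)
    (hproj : ∀ x ∈ X, ∃ a ∈ A, ∀ q ∈ A, d x a + d a q ≤ d x q + K) :
    FourPoint S d (3 * δ + 8 * K + 4) := by
  choose! a haA haK using hproj
  have hdX := hd.mono hXS
  have haX : ∀ x ∈ X, a x ∈ X := fun x hx => hAX (haA x hx)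
  have hsm : ∀ x ∈ S, ∀ y ∈ S, d (σ x) y = d x (σ y) := fun x hx y hy => by
    rw [← hσd (σ x) (hσS x hx) y hy, hσσ x hx]
  -- distances to reflected points
  have U : ∀ x ∈ X, ∀ y ∈ X, d x (σ y) ≤ d x (a y) + d y (a y) := fun x hx y hy => by
    have h1 := hd.triangle x (hXS hx) (a y) (hXS (haX y hy)) (σ y) (hσS y (hXS hy))
    have h2 := hσd (a y) (hXS (haX y hy)) y (hXS hy)
    rw [hσA _ (haA y hy)] at h2
    linarith [hdX.symm y hy _ (haX y hy)]
  have Lo : ∀ x ∈ X, ∀ y ∈ X,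
      d x (a x) + d (a x) (a y) + d y (a y) ≤ d x (σ y) + 2 * K + 1 := fun x hx y hy => by
    obtain ⟨q, hq, h⟩ := hcross x hx y hy
    have h2 := hσd q (hXS (hAX hq)) y (hXS hy)
    rw [hσA _ hq] at h2
    have h3 := haK x hx q hq
    have h5 := haK y hy q hq
    have h6 := hdX.triangle (a x) (haX x hx) q (hAX hq) (a y) (haX y hy)
    linarith [hdX.symm y hy q (hAX hq), hdX.symm _ (haX y hy) q (hAX hq)]
  have T : ∀ x ∈ X, ∀ y ∈ X, d x (a y) ≤ d x (a x) + d (a x) (a y) := fun x hx y hy =>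
    hdX.triangle x hx _ (haX x hx) _ (haX y hy)
  have Lo' : ∀ x ∈ X, ∀ y ∈ X, d x (a y) + d y (a y) ≤ d x (σ y) + 2 * K + 1 :=
    fun x hx y hy => by linarith [T x hx y hy, Lo x hx y hy]
  -- points of `X` far from `A` relative to their distance project to nearby points
  have D : ∀ x ∈ X, ∀ y ∈ X, d (a x) (a y) ≤ 2 * K + δ ∨
      d x (a x) + d y (a y) + d (a x) (a y) ≤ d x y + 2 * K + δ := fun x hx y hy => by
    have h := h4 x hx (a x) (haX x hx) (a y) (haX y hy) y hy
    have e1 := haK x hx (a y) (haA y hy)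
    have e2 := haK y hy (a x) (haA x hx)
    have s1 := hdX.symm (a x) (haX x hx) y hy
    have s2 := hdX.symm (a y) (haX y hy) y hy
    have s3 := hdX.symm (a x) (haX x hx) (a y) (haX y hy)
    have := hdX.nonneg (a x) (haX x hx) (a y) (haX y hy)
    rcases max_choice (d x (a x) + d (a y) y) (d x y + d (a x) (a y)) with h' | h' <;>
      rw [h'] at h
    · left; linarith
    · right; linarith
  have sy := hd.symm
  have P31 : ∀ x ∈ X, ∀ y ∈ X, ∀ z ∈ X, ∀ w ∈ X,
      d x z + d y (σ w) ≤ max (d x y + d z (σ w)) (d x (σ w) + d y z) + (δ + 2 * K + 1) := by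
    intro x hx y hy z hz w hw
    have h := h4 x hx y hy z hz (a w) (haX w hw)
    have h1 := U y hy w hw
    have h2 := Lo' x hx w hw
    have h3 := Lo' z hz w hw
    rcases max_choice (d x y + d z (a w)) (d x (a w) + d y z) with h' | h' <;> rw [h'] at h
    · linarith [le_max_left (d x y + d z (σ w)) (d x (σ w) + d y z)]
    · linarith [le_max_right (d x y + d z (σ w)) (d x (σ w) + d y z)]
  have P22a : ∀ x ∈ X, ∀ y ∈ X, ∀ z ∈ X, ∀ w ∈ X, d x z + d y w ≤
      max (d x (σ y) + d z (σ w)) (d x (σ w) + d z (σ y)) + (δ + 4 * K + 2) := by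
    intro x hx y hy z hz w hw
    have h := h4 (a x) (haX x hx) (a y) (haX y hy) (a z) (haX z hz) (a w) (haX w hw)
    have t1 := hdX.triangle x hx (a z) (haX z hz) z hz
    have t2 := hdX.triangle y hy (a w) (haX w hw) w hw
    have s1 := hdX.symm z hz (a z) (haX z hz)
    have s2 := hdX.symm w hw (a w) (haX w hw)
    have s3 := hdX.symm (a y) (haX y hy) (a z) (haX z hz)
    have := T x hx z hz
    have := T y hy w hw
    have := Lo x hx y hy
    have := Lo z hz w hw
    have := Lo x hx w hw
    have := Lo z hz y hy
    rcases max_choice (d (a x) (a y) + d (a z) (a w)) (d (a x) (a w) + d (a y) (a z)) with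
      h' | h' <;> rw [h'] at h
    · linarith [le_max_left (d x (σ y) + d z (σ w)) (d x (σ w) + d z (σ y))]
    · linarith [le_max_right (d x (σ y) + d z (σ w)) (d x (σ w) + d z (σ y))]
  have P22b : ∀ x ∈ X, ∀ y ∈ X, ∀ z ∈ X, ∀ w ∈ X, d x (σ z) + d y (σ w) ≤
      max (d x y + d z w) (d x (σ w) + d y (σ z)) + (3 * δ + 8 * K + 4) := by
    intro x hx y hy z hz w hw
    have h := h4 (a x) (haX x hx) (a y) (haX y hy) (a z) (haX z hz) (a w) (haX w hw)
    have u1 := U x hx z hz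
    have u2 := U y hy w hw
    have := T x hx z hz
    have := T y hy w hw
    have := Lo x hx w hw
    have := Lo y hy z hz
    have t1 := hdX.triangle (a x) (haX x hx) (a y) (haX y hy) (a z) (haX z hz)
    have t2 := hdX.triangle (a y) (haX y hy) (a x) (haX x hx) (a w) (haX w hw)
    have t3 := hdX.triangle (a x) (haX x hx) (a w) (haX w hw) (a z) (haX z hz)
    have t4 := hdX.triangle (a y) (haX y hy) (a z) (haX z hz) (a w) (haX w hw)
    have s1 := hdX.symm (a x) (haX x hx) (a y) (haX y hy)
    have s2 := hdX.symm (a z) (haX z hz) (a w) (haX w hw)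
    have l := le_max_left (d x y + d z w) (d x (σ w) + d y (σ z))
    have r := le_max_right (d x y + d z w) (d x (σ w) + d y (σ z))
    rcases D x hx y hy with h1 | h1
    · linarith
    rcases D z hz w hw with h2 | h2
    · linarith
    rcases max_choice (d (a x) (a y) + d (a z) (a w)) (d (a x) (a w) + d (a y) (a z)) with
      h' | h' <;> rw [h'] at h
    · linarith
    · linarith
  have half : ∀ x ∈ X, ∀ y ∈ S, ∀ z ∈ S, ∀ w ∈ S,
      d x z + d y w ≤ max (d x y + d z w) (d x w + d y z) + (3 * δ + 8 * K + 4) := by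
    intro x hx y hy z hz w hw
    have hxS := hXS hx
    have red : ∀ u ∈ S, u ∈ X ∨ ∃ v ∈ X, u = σ v := fun u hu =>
      (hcover u hu).imp_right fun h => ⟨σ u, h, (hσσ u hu).symm⟩
    rcases red y hy with hy' | ⟨y, hy', rfl⟩ <;> rcases red z hz with hz' | ⟨z, hz', rfl⟩ <;>
      rcases red w hw with hw' | ⟨w, hw', rfl⟩
    · linarith [h4 x hx y hy' z hz' w hw']
    · linarith [P31 x hx y hy' z hz' w hw']
    · have := P31 y hy' x hx w hw' z hz'
      rw [sy y hy x hxS, sy w hw _ hz, add_comm (d y (σ z))] at this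
      linarith
    · have h := P22b x hx y hy' z hz' w hw'
      rw [hσd z (hXS hz') w (hXS hw')]
      linarith
    · have h := P31 x hx w hw' z hz' y hy'
      rw [sy w hw _ hy, sy z hz _ hy, sy w hw z hz, max_comm] at h
      linarith
    · have h := P22a x hx y hy' z hz' w hw'
      rw [hσd y (hXS hy') w (hXS hw'), sy _ hy z hz]
      linarith
    · have h := P22b x hx w hw' z hz' y hy'
      rw [hσd y (hXS hy') z (hXS hz'), sy _ hy w hw, sy _ hz w hw]
      rw [max_comm, sy z (hXS hz') y (hXS hy')] at h
      linarith
    · have h := P31 w hw' z hz' y hy' x hx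
      rw [hσd y (hXS hy') w (hXS hw'), hσd z (hXS hz') w (hXS hw'),
        hσd y (hXS hy') z (hXS hz')]
      rw [sy w (hXS hw') y (hXS hy'), ← hsm z (hXS hz') x hxS, ← hsm y (hXS hy') x hxS,
        ← hsm w (hXS hw') x hxS, sy _ hz x hxS, sy _ hy x hxS, sy _ hw x hxS,
        sy w (hXS hw') z (hXS hz'), sy z (hXS hz') y (hXS hy')] at h
      rw [add_comm (d x (σ y)), add_comm (d x (σ z))]
      linarith
  intro x hx y hy z hz w hw
  rcases hcover x hx with hx' | hx'
  · exact half x hx' y hy z hz w hw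
  · have h := half (σ x) hx' (σ y) (hσS y hy) (σ z) (hσS z hz) (σ w) (hσS w hw)
    rwa [hσd x hx z hz, hσd y hy w hw, hσd x hx y hy, hσd z hz w hw, hσd x hx w hw,
      hσd y hy z hz] at h

end FourPoint

section Length

variable {S : Set ℂ} {ρ : ℂ → ℝ} {z w v : ℂ} {Γ : ℝ → ℂ}

/-- A `C¹` curve in `S` that equals `z` on `(-∞, 0]` and `w` on `[1, ∞)`. -/
structure IsArc (S : Set ℂ) (z w : ℂ) (Γ : ℝ → ℂ) : Prop where
  contDiff : ContDiff ℝ 1 Γ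
  mem : ∀ t, Γ t ∈ S
  left : ∀ t ≤ 0, Γ t = z
  right : ∀ t, 1 ≤ t → Γ t = w

theorem curveLen_nonneg (hρ : ∀ z ∈ S, 0 ≤ ρ z) (hΓ : ∀ t ∈ Icc (0:ℝ) 1, Γ t ∈ S) :
    0 ≤ curveLen ρ Γ :=
  intervalIntegral.integral_nonneg zero_le_one fun t ht =>
    mul_nonneg (hρ _ (hΓ t ht)) (norm_nonneg _)

theorem densityDist_nonneg (hρ : ∀ z ∈ S, 0 ≤ ρ z) : 0 ≤ densityDist S ρ z w := by
  refine Real.sInf_nonneg ?_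
  rintro _ ⟨γ, -, -, -, hγ, rfl⟩
  exact curveLen_nonneg hρ hγ

theorem continuous_integrand (hc : ContinuousOn ρ S) (hΓ : ContDiff ℝ 1 Γ) (hm : ∀ t, Γ t ∈ S) :
    Continuous fun t => ρ (Γ t) * ‖deriv Γ t‖ :=
  (hc.comp_continuous hΓ.continuous hm).mul (hΓ.continuous_deriv le_rfl).norm

/-- Affine reparametrization: a subarc bounds the distance of its endpoints. -/
theorem densityDist_le_integral (hρ : ∀ z ∈ S, 0 ≤ ρ z) {a b : ℝ} (hab : a ≤ b)
    (hΓ : ContDiff ℝ 1 Γ) (hm : ∀ t ∈ Icc a b, Γ t ∈ S) :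
    densityDist S ρ (Γ a) (Γ b) ≤ ∫ t in a..b, ρ (Γ t) * ‖deriv Γ t‖ := by
  have hmap : ∀ t ∈ Icc (0:ℝ) 1, Γ (a + (b - a) * t) ∈ S := fun t ht =>
    hm _ ⟨by nlinarith [ht.1], by nlinarith [ht.2]⟩
  have hlen : curveLen ρ (fun t => Γ (a + (b - a) * t)) = ∫ t in a..b, ρ (Γ t) * ‖deriv Γ t‖ := by
    have hd : ∀ t, deriv (fun t => Γ (a + (b - a) * t)) t =
        (b - a) • deriv Γ (a + (b - a) * t) := fun t => by
      have h1 : HasDerivAt (fun t : ℝ => a + (b - a) * t) (b - a) t := by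
        simpa using ((hasDerivAt_id t).const_mul (b - a)).const_add a
      exact (((hΓ.differentiable one_ne_zero _).hasDerivAt).scomp t h1).deriv
    unfold curveLen
    simp only [hd, norm_smul, Real.norm_eq_abs, abs_of_nonneg (sub_nonneg.2 hab)]
    have := intervalIntegral.smul_integral_comp_add_mul (a := 0) (b := 1)
      (fun t => ρ (Γ t) * ‖deriv Γ t‖) (b - a) a
    simp only [mul_zero, add_zero, mul_one, add_sub_cancel, smul_eq_mul] at this
    rw [← this, ← intervalIntegral.integral_const_mul]
    congr 1
    ext t
    ring
  rw [← hlen]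
  refine csInf_le ⟨0, ?_⟩ ⟨fun t => Γ (a + (b - a) * t), ?_, by simp, by simp, hmap, rfl⟩
  · rintro _ ⟨γ, -, -, -, hγ, rfl⟩
    exact curveLen_nonneg hρ hγ
  · exact (hΓ.comp (contDiff_const.add (contDiff_const.mul contDiff_id))).contDiffOn

/-- Every admissible curve can be reparametrized to an arc without changing its length. -/
theorem exists_isArc_of_contDiffOn (hc : ContinuousOn ρ S) (hΓ : ContDiffOn ℝ 1 Γ (Icc 0 1))
    (h0 : Γ 0 = z) (h1 : Γ 1 = w) (hm : ∀ t ∈ Icc (0:ℝ) 1, Γ t ∈ S) :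
    ∃ γ, IsArc S z w γ ∧ curveLen ρ γ = curveLen ρ Γ := by
  have hu : ∀ t, Real.smoothTransition t ∈ Icc (0:ℝ) 1 := fun t =>
    ⟨Real.smoothTransition.nonneg t, Real.smoothTransition.le_one t⟩
  have hud : ContDiff ℝ 1 Real.smoothTransition := Real.smoothTransition.contDiff
  have hγ : ContDiff ℝ 1 (fun t => Γ (Real.smoothTransition t)) := by
    rw [← contDiffOn_univ]
    exact hΓ.comp hud.contDiffOn fun t _ => hu t
  have hmono : Monotone Real.smoothTransition := Real.smoothTransition.monotone
  refine ⟨_, ⟨hγ, fun t => hm _ (hu t), fun t ht => ?_, fun t ht => ?_⟩, ?_⟩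
  · rw [Real.smoothTransition.zero_of_nonpos ht, h0]
  · rw [Real.smoothTransition.one_of_one_le ht, h1]
  · have hcont : ContinuousOn (fun t => ρ (Γ t) * ‖derivWithin Γ (Icc 0 1) t‖) (Icc 0 1) :=
      (hc.comp hΓ.continuousOn hm).mul
        (hΓ.continuousOn_derivWithin (uniqueDiffOn_Icc zero_lt_one) le_rfl).norm
    have e1 : curveLen ρ Γ = ∫ t in (0:ℝ)..1, ρ (Γ t) * ‖derivWithin Γ (Icc 0 1) t‖ := by
      refine intervalIntegral.integral_congr_ae ?_
      filter_upwards [MeasureTheory.Measure.ae_ne MeasureTheory.volume (1:ℝ)] with t ht1 ht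
      rw [uIoc_of_le zero_le_one] at ht
      rw [derivWithin_of_mem_nhds (Icc_mem_nhds ht.1 (lt_of_le_of_ne ht.2 ht1))]
    have hderiv : ∀ t, deriv (fun t => Γ (Real.smoothTransition t)) t =
        deriv Real.smoothTransition t • derivWithin Γ (Icc 0 1) (Real.smoothTransition t) := by
      intro t
      have h1 := ((hΓ.differentiableOn one_ne_zero) _ (hu t)).hasDerivWithinAt
      have h2 := ((hud.differentiable one_ne_zero) t).hasDerivAt.hasDerivWithinAt (s := univ)
      have h3 := h1.scomp t h2 (fun s _ => hu s)
      rw [hasDerivWithinAt_univ] at h3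
      exact h3.deriv
    have := intervalIntegral.integral_comp_mul_deriv' (a := 0) (b := 1)
      (f := Real.smoothTransition) (f' := deriv Real.smoothTransition)
      (g := fun t => ρ (Γ t) * ‖derivWithin Γ (Icc 0 1) t‖)
      (fun t _ => ((hud.differentiable one_ne_zero) t).hasDerivAt)
      (hud.continuous_deriv le_rfl).continuousOn
      (hcont.mono (by rintro _ ⟨t, -, rfl⟩; exact hu t))
    rw [Real.smoothTransition.zero, Real.smoothTransition.one] at this
    rw [e1, ← this]
    unfold curveLen
    congr 1
    ext t
    have hnn : 0 ≤ deriv Real.smoothTransition t := hmono.deriv_nonneg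
    simp only [hderiv, norm_smul, Real.norm_eq_abs, abs_of_nonneg hnn, Function.comp]
    ring

theorem IsArc.symm (h : IsArc S z w Γ) : IsArc S w z (fun t => Γ (1 - t)) where
  contDiff := h.contDiff.comp (contDiff_const.sub contDiff_id)
  mem t := h.mem _
  left t ht := h.right _ (by linarith)
  right t ht := h.left _ (by linarith)

theorem curveLen_comp_one_sub : curveLen ρ (fun t => Γ (1 - t)) = curveLen ρ Γ := by
  unfold curveLen
  simp only [deriv_comp_const_sub, norm_neg]
  simpa using intervalIntegral.integral_comp_sub_left (a := 0) (b := 1)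
    (fun t => ρ (Γ t) * ‖deriv Γ t‖) 1

theorem IsArc.exists_trans (hc : ContinuousOn ρ S) {Γ' : ℝ → ℂ} (h : IsArc S z v Γ)
    (h' : IsArc S v w Γ') :
    ∃ γ, IsArc S z w γ ∧ curveLen ρ γ = curveLen ρ Γ + curveLen ρ Γ' := by
  set γ : ℝ → ℂ := fun t => Γ (2 * t) + Γ' (2 * t - 1) - v with hγ_def
  have hγl : ∀ t ≤ 1 / 2, γ t = Γ (2 * t) := fun t ht => by
    simp [hγ_def, h'.left (2 * t - 1) (by linarith)]
  have hγr : ∀ t, 1 / 2 ≤ t → γ t = Γ' (2 * t - 1) := fun t ht => by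
    simp [hγ_def, h.right (2 * t) (by linarith)]
  have hγ : IsArc S z w γ := by
    refine ⟨?_, fun t => ?_, fun t ht => ?_, fun t ht => ?_⟩
    · exact ((h.contDiff.comp (contDiff_const.mul contDiff_id)).add
        (h'.contDiff.comp ((contDiff_const.mul contDiff_id).sub contDiff_const))).sub contDiff_const
    · rcases le_total t (1 / 2) with ht | ht
      · rw [hγl t ht]; exact h.mem _
      · rw [hγr t ht]; exact h'.mem _
    · rw [hγl t (by linarith), h.left _ (by linarith)]
    · rw [hγr t (by linarith), h'.right _ (by linarith)]
  refine ⟨γ, hγ, ?_⟩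
  have hcont := continuous_integrand hc hγ.contDiff hγ.mem
  unfold curveLen
  rw [← intervalIntegral.integral_add_adjacent_intervals (b := 1 / 2)
    (hcont.intervalIntegrable _ _) (hcont.intervalIntegrable _ _)]
  have hh : ∀ᵐ t : ℝ, t ≠ 1 / 2 := MeasureTheory.Measure.ae_ne MeasureTheory.volume _
  congr 1
  · have e := intervalIntegral.smul_integral_comp_mul_left (a := 0) (b := 1 / 2)
      (fun t => ρ (Γ t) * ‖deriv Γ t‖) 2
    simp only [mul_zero, mul_one_div_cancel (two_ne_zero' ℝ), smul_eq_mul] at e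
    rw [← e, ← intervalIntegral.integral_const_mul]
    refine intervalIntegral.integral_congr_ae ?_
    filter_upwards [hh] with t ht1 ht
    rw [uIoc_of_le (by norm_num)] at ht
    have h1 : γ =ᶠ[nhds t] fun s => Γ (2 * s) := by
      filter_upwards [Iio_mem_nhds (lt_of_le_of_ne ht.2 ht1)] with s hs using hγl s hs.le
    rw [h1.deriv_eq, h1.eq_of_nhds, deriv_comp_mul_left, norm_smul]
    norm_num
    ring
  · have e := intervalIntegral.smul_integral_comp_mul_sub (a := 1 / 2) (b := 1)
      (fun t => ρ (Γ' t) * ‖deriv Γ' t‖) 2 1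
    norm_num at e
    rw [← e, ← intervalIntegral.integral_const_mul]
    refine intervalIntegral.integral_congr_ae ?_
    filter_upwards [] with t ht
    rw [uIoc_of_le (by norm_num)] at ht
    have h1 : γ =ᶠ[nhds t] fun s => Γ' (2 * s - 1) := by
      filter_upwards [Ioi_mem_nhds ht.1] with s hs using hγr s (le_of_lt hs)
    have h2 : deriv (fun s => Γ' (2 * s - 1)) t = (2:ℝ) • deriv Γ' (2 * t - 1) := by
      rw [deriv_comp_mul_left (f := fun s => Γ' (s - 1)), deriv_comp_sub_const]
    rw [h1.deriv_eq, h1.eq_of_nhds, h2, norm_smul]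
    norm_num
    ring

theorem IsArc.densityDist_le (hρ : ∀ z ∈ S, 0 ≤ ρ z) (h : IsArc S z w Γ) :
    densityDist S ρ z w ≤ curveLen ρ Γ := by
  have := densityDist_le_integral hρ zero_le_one h.contDiff fun t _ => h.mem t
  rwa [h.left 0 le_rfl, h.right 1 le_rfl] at this

theorem exists_isArc_lt (hc : ContinuousOn ρ S) (hS : ∃ Γ, IsArc S z w Γ) {L : ℝ}
    (hL : densityDist S ρ z w < L) : ∃ Γ, IsArc S z w Γ ∧ curveLen ρ Γ < L := by
  obtain ⟨Γ, hΓ⟩ := hS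
  have hne : { L | ∃ γ : ℝ → ℂ, ContDiffOn ℝ 1 γ (Icc 0 1) ∧ γ 0 = z ∧ γ 1 = w ∧
      (∀ t ∈ Icc (0:ℝ) 1, γ t ∈ S) ∧ L = curveLen ρ γ }.Nonempty :=
    ⟨_, Γ, hΓ.contDiff.contDiffOn, hΓ.left 0 le_rfl, hΓ.right 1 le_rfl,
      fun t _ => hΓ.mem t, rfl⟩
  obtain ⟨_, ⟨γ, h1, h2, h3, h4, rfl⟩, hlt⟩ := exists_lt_of_csInf_lt hne hL
  obtain ⟨γ', h5, h6⟩ := exists_isArc_of_contDiffOn hc h1 h2 h3 h4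
  exact ⟨γ', h5, h6.trans_lt hlt⟩

/-- To bound `densityDist` from below it suffices to bound lengths of arcs. -/
theorem le_densityDist (hc : ContinuousOn ρ S) (hS : ∃ Γ, IsArc S z w Γ) {L : ℝ}
    (hL : ∀ Γ, IsArc S z w Γ → L ≤ curveLen ρ Γ) : L ≤ densityDist S ρ z w := by
  by_contra! h
  obtain ⟨Γ, h1, h2⟩ := exists_isArc_lt hc hS h
  exact absurd (hL Γ h1) (not_le.2 h2)

theorem isPseudoDistOn_densityDist (hc : ContinuousOn ρ S) (hρ : ∀ z ∈ S, 0 ≤ ρ z)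
    (hS : ∀ z ∈ S, ∀ w ∈ S, ∃ Γ, IsArc S z w Γ) : IsPseudoDistOn S (densityDist S ρ) where
  nonneg _ _ _ _ := densityDist_nonneg hρ
  self x hx := by
    refine le_antisymm ?_ (densityDist_nonneg hρ)
    have h : IsArc S x x fun _ => x :=
      ⟨contDiff_const, fun _ => hx, fun _ _ => rfl, fun _ _ => rfl⟩
    simpa [curveLen] using h.densityDist_le hρ
  symm x hx y hy := by
    have key : ∀ x ∈ S, ∀ y ∈ S, densityDist S ρ x y ≤ densityDist S ρ y x := fun x hx y hy =>
      le_densityDist hc (hS y hy x hx) fun Γ hΓ => by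
        rw [← curveLen_comp_one_sub]
        exact hΓ.symm.densityDist_le hρ
    exact le_antisymm (key x hx y hy) (key y hy x hx)
  triangle x hx y hy z hz := by
    refine le_of_forall_pos_le_add fun ε hε => ?_
    obtain ⟨Γ, h1, h2⟩ := exists_isArc_lt hc (hS x hx y hy)
      (lt_add_of_pos_right (densityDist S ρ x y) (half_pos hε))
    obtain ⟨Γ', h1', h2'⟩ := exists_isArc_lt hc (hS y hy z hz)
      (lt_add_of_pos_right (densityDist S ρ y z) (half_pos hε))
    obtain ⟨γ, h3, h4⟩ := h1.exists_trans hc h1'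
    linarith [h3.densityDist_le hρ]

/-- A point cutting an almost shortest arc into two pieces of prescribed lengths. -/
theorem exists_point_at_dist (hc : ContinuousOn ρ S) (hρ : ∀ z ∈ S, 0 ≤ ρ z)
    (hS : ∃ Γ, IsArc S z w Γ) {t : ℝ} (h0 : 0 ≤ t) (ht : t ≤ densityDist S ρ z w) :
    ∃ m ∈ S, densityDist S ρ z m ≤ t ∧ densityDist S ρ m w ≤ densityDist S ρ z w - t + 1 := by
  obtain ⟨Γ, h1, h2⟩ := exists_isArc_lt hc hS (lt_add_one (densityDist S ρ z w))
  have hcont := continuous_integrand hc h1.contDiff h1.mem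
  obtain ⟨τ, hτ, hτt⟩ : t ∈ (fun s => ∫ u in (0:ℝ)..s, ρ (Γ u) * ‖deriv Γ u‖) '' Icc 0 1 := by
    refine intermediate_value_Icc zero_le_one
      (intervalIntegral.continuous_primitive (μ := MeasureTheory.volume)
        (fun a b => hcont.intervalIntegrable a b) 0).continuousOn
      ⟨by simpa using h0, ?_⟩
    exact ht.trans (h1.densityDist_le hρ)
  have e1 := densityDist_le_integral hρ hτ.1 h1.contDiff fun t _ => h1.mem t
  have e2 := densityDist_le_integral hρ hτ.2 h1.contDiff fun t _ => h1.mem t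
  have e3 := intervalIntegral.integral_add_adjacent_intervals
    (hcont.intervalIntegrable (μ := MeasureTheory.volume) 0 τ) (hcont.intervalIntegrable τ 1)
  rw [h1.left 0 le_rfl] at e1
  rw [h1.right 1 le_rfl] at e2
  unfold curveLen at h2
  simp only at hτt
  exact ⟨Γ τ, h1.mem τ, by linarith, by linarith⟩

/-- A curve between the two closed half planes crosses the real axis. -/
theorem exists_real_crossing (hc : ContinuousOn ρ S) (hρ : ∀ z ∈ S, 0 ≤ ρ z)
    (hS : ∃ Γ, IsArc S z w Γ) (hz : 0 ≤ z.im) (hw : w.im ≤ 0) :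
    ∃ q ∈ S, q.im = 0 ∧
      densityDist S ρ z q + densityDist S ρ q w ≤ densityDist S ρ z w + 1 := by
  obtain ⟨Γ, h1, h2⟩ := exists_isArc_lt hc hS (lt_add_one (densityDist S ρ z w))
  have hcont := continuous_integrand hc h1.contDiff h1.mem
  obtain ⟨τ, hτ, hτt⟩ : (0:ℝ) ∈ (fun s => (Γ s).im) '' Icc 0 1 := by
    refine intermediate_value_Icc' zero_le_one
      (Complex.continuous_im.comp h1.contDiff.continuous).continuousOn ⟨?_, ?_⟩
    · rwa [Function.comp, h1.right 1 le_rfl]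
    · rwa [Function.comp, h1.left 0 le_rfl]
  have e1 := densityDist_le_integral hρ hτ.1 h1.contDiff fun t _ => h1.mem t
  have e2 := densityDist_le_integral hρ hτ.2 h1.contDiff fun t _ => h1.mem t
  have e3 := intervalIntegral.integral_add_adjacent_intervals
    (hcont.intervalIntegrable (μ := MeasureTheory.volume) 0 τ) (hcont.intervalIntegrable τ 1)
  rw [h1.left 0 le_rfl] at e1
  rw [h1.right 1 le_rfl] at e2
  unfold curveLen at h2
  exact ⟨Γ τ, h1.mem τ, hτt, by linarith⟩

/-- Maps that do not increase the density do not increase distances. -/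
theorem densityDist_comp_le {T : Set ℂ} {ρ' : ℂ → ℝ} (hc : ContinuousOn ρ S)
    (hc' : ContinuousOn ρ' T) (hρ' : ∀ z ∈ T, 0 ≤ ρ' z) (hS : ∃ Γ, IsArc S z w Γ) {φ : ℂ → ℂ}
    (hmap : MapsTo φ S T) (hφ : ∀ Γ : ℝ → ℂ, ContDiff ℝ 1 Γ → (∀ t, Γ t ∈ S) →
      ContDiff ℝ 1 (φ ∘ Γ) ∧ ∀ t, ρ' (φ (Γ t)) * ‖deriv (φ ∘ Γ) t‖ ≤ ρ (Γ t) * ‖deriv Γ t‖) :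
    densityDist T ρ' (φ z) (φ w) ≤ densityDist S ρ z w := by
  refine le_densityDist hc hS fun Γ hΓ => ?_
  obtain ⟨h1, h2⟩ := hφ Γ hΓ.contDiff hΓ.mem
  have h3 := densityDist_le_integral (S := T) (ρ := ρ') hρ' zero_le_one h1
    fun t _ => hmap (hΓ.mem t)
  simp only [Function.comp, hΓ.left 0 le_rfl, hΓ.right 1 le_rfl] at h3
  refine h3.trans (intervalIntegral.integral_mono zero_le_one
    ((continuous_integrand hc' h1 fun t => hmap (hΓ.mem t)).intervalIntegrable _ _)
    ((continuous_integrand hc hΓ.contDiff hΓ.mem).intervalIntegrable _ _) h2)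

/-- Straight segments as arcs. -/
theorem exists_isArc_segment (h : segment ℝ z w ⊆ S) : ∃ Γ, IsArc S z w Γ := by
  refine ⟨fun t => z + Real.smoothTransition t • (w - z), ?_, fun t => h ?_, fun t ht => ?_,
    fun t ht => ?_⟩
  · exact contDiff_const.add (Real.smoothTransition.contDiff.smul contDiff_const)
  · rw [segment_eq_image']
    exact ⟨_, ⟨Real.smoothTransition.nonneg t, Real.smoothTransition.le_one t⟩, rfl⟩
  · simp [Real.smoothTransition.zero_of_nonpos ht]
  · simp [Real.smoothTransition.one_of_one_le ht]

end Length

section Quasihyperbolic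

variable {Ω : Set ℂ} {z w : ℂ} {Γ : ℝ → ℂ}

theorem infDist_compl_pos (hΩ : IsOpen Ω) (hne : Ωᶜ.Nonempty) (hz : z ∈ Ω) :
    0 < infDist z Ωᶜ :=
  (hΩ.isClosed_compl.notMem_iff_infDist_pos hne).1 fun h => h hz

theorem qhDensity_nonneg : ∀ z ∈ Ω, 0 ≤ qhDensity Ω z := fun _ _ =>
  inv_nonneg.2 infDist_nonneg

theorem continuousOn_qhDensity (hΩ : IsOpen Ω) (hne : Ωᶜ.Nonempty) :
    ContinuousOn (qhDensity Ω) Ω :=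
  (continuous_infDist_pt _).continuousOn.inv₀ fun _ hz => (infDist_compl_pos hΩ hne hz).ne'

theorem log_one_add_div_le_integral (hΩ : IsOpen Ω) (hne : Ωᶜ.Nonempty) {a b : ℝ} (hab : a ≤ b)
    (hΓ : ContDiff ℝ 1 Γ) (hm : ∀ t, Γ t ∈ Ω) :
    Real.log (1 + ‖Γ b - Γ a‖ / infDist (Γ a) Ωᶜ) ≤
      ∫ t in a..b, qhDensity Ω (Γ t) * ‖deriv Γ t‖ := by
  have hd := infDist_compl_pos hΩ hne (hm a)
  set d := infDist (Γ a) Ωᶜ with hd_def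
  have hnc : Continuous fun t => ‖deriv Γ t‖ := (hΓ.continuous_deriv le_rfl).norm
  set L : ℝ → ℝ := fun t => ∫ u in a..t, ‖deriv Γ u‖ with hL
  have hLd : ∀ t, HasDerivAt L ‖deriv Γ t‖ t := fun t =>
    intervalIntegral.integral_hasDerivAt_right (hnc.intervalIntegrable _ _)
      (hnc.stronglyMeasurableAtFilter _ _) hnc.continuousAt
  have hL0 : ∀ t, a ≤ t → 0 ≤ L t := fun t ht =>
    intervalIntegral.integral_nonneg ht fun _ _ => norm_nonneg _
  have hLn : ∀ t, a ≤ t → ‖Γ t - Γ a‖ ≤ L t := fun t ht => by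
    rw [← intervalIntegral.integral_deriv_eq_sub
      (fun s _ => hΓ.differentiable one_ne_zero s)
      ((hΓ.continuous_deriv le_rfl).intervalIntegrable _ _)]
    exact intervalIntegral.norm_integral_le_integral_norm ht
  have hLc : Continuous L := continuous_iff_continuousAt.2 fun t => (hLd t).continuousAt
  have hInt : IntervalIntegrable (fun t => ‖deriv Γ t‖ / (d + L t)) MeasureTheory.volume a b := by
    refine ContinuousOn.intervalIntegrable ?_
    refine hnc.continuousOn.div (continuous_const.add hLc).continuousOn fun t ht => ?_
    rw [uIcc_of_le hab] at ht
    have := hL0 t ht.1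
    positivity
  have e := intervalIntegral.integral_eq_sub_of_hasDerivAt
    (f := fun t => Real.log (d + L t)) (f' := fun t => ‖deriv Γ t‖ / (d + L t)) (a := a) (b := b)
    (fun t ht => by
      rw [uIcc_of_le hab] at ht
      have := hL0 t ht.1
      exact ((hLd t).const_add d).log (by positivity)) hInt
  have hLa : L a = 0 := by simp [hL]
  have h1 : Real.log (1 + ‖Γ b - Γ a‖ / d) ≤ ∫ t in a..b, ‖deriv Γ t‖ / (d + L t) := by
    rw [e, hLa, add_zero, ← Real.log_div (by have := hL0 b hab; positivity) hd.ne']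
    refine Real.log_le_log (by positivity) ?_
    rw [add_div, div_self hd.ne']
    gcongr
    exact hLn b hab
  refine h1.trans (intervalIntegral.integral_mono_on hab hInt
    ((continuous_integrand (continuousOn_qhDensity hΩ hne) hΓ hm).intervalIntegrable _ _)
    fun t ht => ?_)
  rw [div_eq_inv_mul]
  refine mul_le_mul_of_nonneg_right ?_ (norm_nonneg _)
  refine inv_anti₀ (infDist_compl_pos hΩ hne (hm t)) ?_
  have := infDist_le_infDist_add_dist (s := Ωᶜ) (x := Γ t) (y := Γ a)
  rw [dist_eq_norm] at this
  linarith [hLn t ht.1]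

theorem log_add_log_le_curveLen (hΩ : IsOpen Ω) (hne : Ωᶜ.Nonempty) (h : IsArc Ω z w Γ) :
    Real.log (1 + ‖z - w‖ / (2 * infDist z Ωᶜ)) + Real.log (1 + ‖z - w‖ / (2 * infDist w Ωᶜ)) ≤
      curveLen (qhDensity Ω) Γ := by
  have hz : z ∈ Ω := h.left 0 le_rfl ▸ h.mem 0
  have hw : w ∈ Ω := h.right 1 le_rfl ▸ h.mem 1
  have hδz := infDist_compl_pos hΩ hne hz
  have hδw := infDist_compl_pos hΩ hne hw
  have hcont := continuous_integrand (continuousOn_qhDensity hΩ hne) h.contDiff h.mem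
  obtain ⟨τ, hτ, hτt⟩ : ‖z - w‖ / 2 ∈ (fun s => ‖Γ s - z‖) '' Icc 0 1 := by
    refine intermediate_value_Icc zero_le_one
      (h.contDiff.continuous.sub continuous_const).norm.continuousOn ⟨?_, ?_⟩
    · rw [Pi.sub_apply, h.left 0 le_rfl, sub_self, norm_zero]
      positivity
    · rw [Pi.sub_apply, h.right 1 le_rfl, norm_sub_rev]
      linarith [norm_nonneg (w - z)]
  have e1 := log_one_add_div_le_integral hΩ hne hτ.1 h.contDiff h.mem
  have e2 := log_one_add_div_le_integral (Γ := fun t => Γ (-t)) hΩ hne (neg_le_neg hτ.2)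
    (h.contDiff.comp contDiff_neg) (fun t => h.mem _)
  have e3 := intervalIntegral.integral_add_adjacent_intervals
    (hcont.intervalIntegrable (μ := MeasureTheory.volume) 0 τ) (hcont.intervalIntegrable τ 1)
  simp only [deriv_comp_neg, norm_neg, neg_neg] at e2
  rw [intervalIntegral.integral_comp_neg (fun t => qhDensity Ω (Γ t) * ‖deriv Γ t‖),
    neg_neg, neg_neg, h.right 1 le_rfl] at e2
  rw [h.left 0 le_rfl] at e1
  simp only at hτt
  have h2 : ‖z - w‖ / 2 ≤ ‖Γ τ - w‖ := by
    have := norm_sub_le_norm_sub_add_norm_sub z (Γ τ) w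
    rw [norm_sub_rev z (Γ τ)] at this
    linarith
  unfold curveLen
  rw [← e3]
  refine add_le_add (le_trans (Real.log_le_log (by positivity) ?_) e1)
    (le_trans (Real.log_le_log (by positivity) ?_) e2)
  · rw [hτt, div_div]
  · rw [← div_div]; gcongr

theorem log_add_log_le_qhDist (hΩ : IsOpen Ω) (hne : Ωᶜ.Nonempty) (h : ∃ Γ, IsArc Ω z w Γ) :
    Real.log (1 + ‖z - w‖ / (2 * infDist z Ωᶜ)) + Real.log (1 + ‖z - w‖ / (2 * infDist w Ωᶜ)) ≤
      qhDist Ω z w :=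
  le_densityDist (continuousOn_qhDensity hΩ hne) h fun _ hΓ =>
    log_add_log_le_curveLen hΩ hne hΓ

/-- A straight segment on which the density is at most `M`. -/
theorem densityDist_le_mul_of_segment {S : Set ℂ} {ρ : ℂ → ℝ} (hc : ContinuousOn ρ S)
    (hρ : ∀ z ∈ S, 0 ≤ ρ z) {M : ℝ} (hS : segment ℝ z w ⊆ S) (hM : ∀ v ∈ segment ℝ z w, ρ v ≤ M) :
    densityDist S ρ z w ≤ M * ‖w - z‖ := by
  have hd : ∀ t : ℝ, HasDerivAt (fun t : ℝ => z + t • (w - z)) (w - z) t := fun t => by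
    simpa using ((hasDerivAt_id t).smul_const (w - z)).const_add z
  have hcd : ContDiff ℝ 1 fun t : ℝ => z + t • (w - z) :=
    contDiff_const.add (contDiff_id.smul contDiff_const)
  have hmem : ∀ t ∈ Icc (0:ℝ) 1, z + t • (w - z) ∈ segment ℝ z w := fun t ht => by
    rw [segment_eq_image']; exact ⟨t, ht, rfl⟩
  have h := densityDist_le_integral hρ zero_le_one hcd fun t ht => hS (hmem t ht)
  simp only [zero_smul, add_zero, one_smul, add_sub_cancel] at h
  refine h.trans ?_
  have h2 : ∫ t in (0:ℝ)..1, ρ (z + t • (w - z)) * ‖deriv (fun t : ℝ => z + t • (w - z)) t‖ ≤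
      ∫ _ in (0:ℝ)..1, M * ‖w - z‖ := by
    refine intervalIntegral.integral_mono_on zero_le_one ?_ (by simp) fun t ht => ?_
    · refine ContinuousOn.intervalIntegrable ?_
      rw [uIcc_of_le zero_le_one]
      exact (hc.comp hcd.continuous.continuousOn fun t ht => hS (hmem t ht)).mul
        (hcd.continuous_deriv le_rfl).norm.continuousOn
    · rw [(hd t).deriv]
      exact mul_le_mul_of_nonneg_right (hM _ (hmem t ht)) (norm_nonneg _)
  simpa using h2

theorem eventually_densityDist_le_one {S : Set ℂ} {ρ : ℂ → ℝ} (hS : IsOpen S)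
    (hc : ContinuousOn ρ S) (hρ : ∀ z ∈ S, 0 ≤ ρ z) (hz : z ∈ S) :
    ∀ᶠ w in nhds z, densityDist S ρ z w ≤ 1 := by
  have h1 : ∀ᶠ v in nhds z, ρ v < ρ z + 1 ∧ v ∈ S :=
    ((hc.continuousAt (hS.mem_nhds hz)).eventually_lt_const (lt_add_one _)).and (hS.mem_nhds hz)
  obtain ⟨ε, hε, hball⟩ := Metric.eventually_nhds_iff_ball.1 h1
  have hρz := hρ z hz
  have hM : 0 < ρ z + 1 := by positivity
  filter_upwards [ball_mem_nhds z (lt_min hε (inv_pos.2 hM))] with w hw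
  rw [mem_ball, lt_min_iff] at hw
  have hseg := (convex_ball z ε).segment_subset (mem_ball_self hε) hw.1
  refine (densityDist_le_mul_of_segment hc hρ (M := ρ z + 1) (fun v hv => (hball v (hseg hv)).2)
    fun v hv => (hball v (hseg hv)).1.le).trans ?_
  rw [← dist_eq_norm]
  exact (mul_le_mul_of_nonneg_left hw.2.le hM.le).trans_eq (mul_inv_cancel₀ hM.ne')

theorem arsinh_le_log_one_add {x : ℝ} (hx : 0 ≤ x) : Real.arsinh x ≤ Real.log (1 + 2 * x) := by
  refine Real.log_le_log (by positivity) ?_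
  have : √(1 + x ^ 2) ≤ 1 + x := Real.sqrt_le_iff.2 ⟨by linarith, by nlinarith⟩
  linarith

theorem sq_add_sq_le_infDist_sq (hne : Ωᶜ.Nonempty) (hH : ∀ e ∈ Ωᶜ, e.im ≤ 0) (hz : 0 ≤ z.im)
    {u : ℝ} (hu : 0 ≤ u) : √(infDist z Ωᶜ ^ 2 + u ^ 2) ≤ infDist (z + u * I) Ωᶜ := by
  refine (le_infDist hne).2 fun e he => Real.sqrt_le_iff.2 ⟨dist_nonneg, ?_⟩
  have h1 : infDist z Ωᶜ ^ 2 ≤ dist z e ^ 2 :=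
    pow_le_pow_left₀ infDist_nonneg (infDist_le_dist_of_mem he) 2
  have h2 : ∀ v : ℂ, dist v e ^ 2 = (v.re - e.re) ^ 2 + (v.im - e.im) ^ 2 := fun v => by
    rw [Complex.dist_eq, Complex.sq_norm, Complex.normSq_apply]; simp; ring
  rw [h2] at h1
  rw [h2]
  simp
  nlinarith [hH e he, mul_nonneg hu (sub_nonneg.2 ((hH e he).trans hz))]

theorem qhDist_vertical_le (hΩ : IsOpen Ω) (hne : Ωᶜ.Nonempty) (hH : ∀ e ∈ Ωᶜ, e.im ≤ 0)
    (hz : z ∈ Ω) (hz0 : 0 ≤ z.im) {r : ℝ} (hr : 0 ≤ r) :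
    qhDist Ω z (z + r * I) ≤ Real.log (1 + 2 * (r / infDist z Ωᶜ)) := by
  have hd := infDist_compl_pos hΩ hne hz
  set d := infDist z Ωᶜ with hd_def
  have hmem : ∀ u ∈ Icc 0 r, z + (u:ℝ) * I ∈ Ω := fun u hu => by
    rcases hu.1.eq_or_lt with h | h
    · simpa [← h] using hz
    · by_contra hcon
      have := hH _ hcon
      simp at this
      linarith
  have hcd : ContDiff ℝ 1 fun u : ℝ => z + u * I :=
    contDiff_const.add (Complex.ofRealCLM.contDiff.mul contDiff_const)
  have hder : ∀ u, deriv (fun u : ℝ => z + u * I) u = I := fun u => by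
    have : HasDerivAt (fun u : ℝ => z + (u:ℂ) * I) (1 * I) u :=
      (((Complex.ofRealCLM.hasDerivAt (x := u))).mul_const I).const_add z
    simpa using this.deriv
  have h := densityDist_le_integral (S := Ω) qhDensity_nonneg hr hcd hmem
  simp only [hder, Complex.norm_I, mul_one, Complex.ofReal_zero, zero_mul, add_zero] at h
  refine h.trans (le_trans ?_ (arsinh_le_log_one_add (x := r / d) (by positivity)))
  have hc' : Continuous fun u : ℝ => (√(1 + (u / d) ^ 2))⁻¹ * (1 / d) := by
    refine (Continuous.inv₀ (by fun_prop) fun u => ?_).mul continuous_const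
    positivity
  have e := intervalIntegral.integral_eq_sub_of_hasDerivAt
    (f := fun u => Real.arsinh (u / d)) (a := 0) (b := r)
    (fun u _ => ((hasDerivAt_id u).div_const d).arsinh)
    (hc'.intervalIntegrable _ _)
  simp only [zero_div, Real.arsinh_zero, sub_zero] at e
  rw [← e]
  refine intervalIntegral.integral_mono_on hr ?_ (hc'.intervalIntegrable _ _) fun u hu => ?_
  · refine ContinuousOn.intervalIntegrable ?_
    rw [uIcc_of_le hr]
    exact (continuousOn_qhDensity hΩ hne).comp hcd.continuous.continuousOn hmem
  · have h3 : d * √(1 + (u / d) ^ 2) = √(d ^ 2 + u ^ 2) := by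
      rw [← Real.sqrt_sq hd.le, ← Real.sqrt_mul (sq_nonneg _), Real.sqrt_sq hd.le]
      congr 1
      field_simp
    have h4 : (√(1 + (u / d) ^ 2))⁻¹ * (1 / d) = (√(d ^ 2 + u ^ 2))⁻¹ := by
      rw [← h3]; field_simp
    simp only [smul_eq_mul, id, h4]
    exact inv_anti₀ (Real.sqrt_pos.2 (by positivity)) (sq_add_sq_le_infDist_sq hne hH hz0 hu.1)

theorem im_le_infDist (hne : Ωᶜ.Nonempty) (hH : ∀ e ∈ Ωᶜ, e.im ≤ 0) : z.im ≤ infDist z Ωᶜ :=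
  (le_infDist hne).2 fun e he => by
    have h1 : |(z - e).im| ≤ ‖z - e‖ := Complex.abs_im_le_norm _
    rw [Complex.dist_eq]
    refine le_trans ?_ ((le_abs_self _).trans h1)
    simp [hH e he]

theorem qhDist_le_log_add_log (hΩ : IsOpen Ω) (hne : Ωᶜ.Nonempty) (hH : ∀ e ∈ Ωᶜ, e.im ≤ 0)
    (hd : IsPseudoDistOn Ω (qhDist Ω)) (hz : z ∈ Ω) (hz0 : 0 ≤ z.im) (hw : w ∈ Ω)
    (hw0 : 0 ≤ w.im) :
    qhDist Ω z w ≤ Real.log (1 + 2 * (‖z - w‖ / infDist z Ωᶜ)) +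
      Real.log (1 + 2 * (‖z - w‖ / infDist w Ωᶜ)) + 1 := by
  set r := ‖z - w‖ with hr_def
  rcases (norm_nonneg (z - w)).eq_or_lt with h | h
  · rw [← hr_def] at h
    have : z = w := sub_eq_zero.1 (norm_eq_zero.1 h.symm)
    subst this
    rw [hd.self z hz, ← h]
    simp
  · rw [← hr_def] at h
    have hmem : ∀ v : ℂ, 0 < v.im → v ∈ Ω := fun v hv => by
      by_contra hcon
      exact absurd (hH v hcon) (not_le.2 hv)
    have h1 := qhDist_vertical_le hΩ hne hH hz hz0 h.le
    have h2 := qhDist_vertical_le hΩ hne hH hw hw0 h.le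
    have hz' : z + r * I ∈ Ω := hmem _ (by simp; linarith)
    have hw' : w + r * I ∈ Ω := hmem _ (by simp; linarith)
    have hseg : ∀ v ∈ segment ℝ (z + r * I) (w + r * I), r ≤ v.im := by
      have hcv : Convex ℝ {v : ℂ | r ≤ v.im} := convex_halfSpace_im_ge r
      exact fun v hv => hcv.segment_subset (by simp [hz0]) (by simp [hw0]) hv
    have h3 : qhDist Ω (z + r * I) (w + r * I) ≤ r⁻¹ * ‖w + r * I - (z + r * I)‖ :=
      densityDist_le_mul_of_segment (continuousOn_qhDensity hΩ hne) qhDensity_nonneg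
        (fun v hv => hmem v (h.trans_le (hseg v hv)))
        fun v hv => inv_anti₀ h ((hseg v hv).trans (im_le_infDist hne hH))
    rw [add_sub_add_right_eq_sub, norm_sub_rev, ← hr_def, inv_mul_cancel₀ h.ne'] at h3
    rw [hd.symm _ hw _ hw'] at h2
    linarith [hd.triangle _ hz _ hz' _ hw, hd.triangle _ hz' _ hw' _ hw]

/-- The quasihyperbolic distance in terms of `‖z - w‖ + δ(z) + δ(w)`. -/
theorem qhDist_estimates (hΩ : IsOpen Ω) (hne : Ωᶜ.Nonempty) (hH : ∀ e ∈ Ωᶜ, e.im ≤ 0)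
    (harc : ∀ z ∈ Ω, ∀ w ∈ Ω, ∃ Γ, IsArc Ω z w Γ) (hz : z ∈ Ω) (hz0 : 0 ≤ z.im) (hw : w ∈ Ω)
    (hw0 : 0 ≤ w.im) :
    2 * Real.log (‖z - w‖ + infDist z Ωᶜ + infDist w Ωᶜ) - 4 * Real.log 2 -
        (Real.log (infDist z Ωᶜ) + Real.log (infDist w Ωᶜ)) ≤ qhDist Ω z w ∧
      qhDist Ω z w ≤ 2 * Real.log (‖z - w‖ + infDist z Ωᶜ + infDist w Ωᶜ) + 2 * Real.log 2 + 1 -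
        (Real.log (infDist z Ωᶜ) + Real.log (infDist w Ωᶜ)) := by
  have hd : IsPseudoDistOn Ω (qhDist Ω) :=
    isPseudoDistOn_densityDist (continuousOn_qhDensity hΩ hne) qhDensity_nonneg harc
  have hlow := log_add_log_le_qhDist hΩ hne (harc z hz w hw)
  have hup := qhDist_le_log_add_log hΩ hne hH hd hz hz0 hw hw0
  have ha := infDist_compl_pos hΩ hne hz
  have hb := infDist_compl_pos hΩ hne hw
  have hba := infDist_le_infDist_add_dist (s := Ωᶜ) (x := w) (y := z)
  have hab := infDist_le_infDist_add_dist (s := Ωᶜ) (x := z) (y := w)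
  rw [dist_comm, dist_eq_norm] at hba
  rw [dist_eq_norm] at hab
  have hr := norm_nonneg (z - w)
  set a := infDist z Ωᶜ
  set b := infDist w Ωᶜ
  set r := ‖z - w‖
  have hN : 0 < r + a + b := by positivity
  have e1 : ∀ c, 0 < c → 1 + r / (2 * c) = (2 * c + r) / (2 * c) := fun c hc => by field_simp
  have e2 : ∀ c, 0 < c → 1 + 2 * (r / c) = (c + 2 * r) / c := fun c hc => by field_simp
  have l2 : Real.log (2 * (r + a + b)) = Real.log 2 + Real.log (r + a + b) :=
    Real.log_mul two_ne_zero hN.ne'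
  have lh : Real.log ((r + a + b) / 2) = Real.log (r + a + b) - Real.log 2 :=
    Real.log_div hN.ne' two_ne_zero
  constructor
  · rw [e1 a ha, e1 b hb, Real.log_div (by positivity) (by positivity),
      Real.log_div (by positivity) (by positivity), Real.log_mul two_ne_zero ha.ne',
      Real.log_mul two_ne_zero hb.ne'] at hlow
    have h1 : Real.log ((r + a + b) / 2) ≤ Real.log (2 * a + r) :=
      Real.log_le_log (by positivity) (by linarith)
    have h2 : Real.log ((r + a + b) / 2) ≤ Real.log (2 * b + r) :=
      Real.log_le_log (by positivity) (by linarith)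
    linarith
  · rw [e2 a ha, e2 b hb, Real.log_div (by positivity) ha.ne',
      Real.log_div (by positivity) hb.ne'] at hup
    have h1 : Real.log (a + 2 * r) ≤ Real.log (2 * (r + a + b)) :=
      Real.log_le_log (by positivity) (by linarith)
    have h2 : Real.log (b + 2 * r) ≤ Real.log (2 * (r + a + b)) :=
      Real.log_le_log (by positivity) (by linarith)
    linarith

theorem mul_le_four_mul_max {a b c d e f : ℝ} (ha : 0 ≤ a) (hb : 0 ≤ b) (hc : 0 ≤ c) (hd : 0 ≤ d)
    (he : 0 ≤ e) (hf : 0 ≤ f)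
    (e1 : e ≤ a + c) (e2 : e ≤ b + d) (f1 : f ≤ a + b) (f2 : f ≤ c + d) :
    e * f ≤ 4 * max (a * d) (b * c) := by
  have two : ∀ {x y u : ℝ}, u ≤ x + y → u ≤ 2 * x ∨ u ≤ 2 * y := fun {x y u} h => by
    by_contra! hcon
    linarith [hcon.1, hcon.2]
  have hmul : ∀ {x y u v : ℝ}, 0 ≤ v → 0 ≤ x → u ≤ 2 * x → v ≤ 2 * y → u * v ≤ 4 * (x * y) :=
    fun {x y u v} hv hx h1 h2 => by
      calc u * v ≤ (2 * x) * (2 * y) := mul_le_mul h1 h2 hv (by linarith)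
        _ = 4 * (x * y) := by ring
  have hl := le_max_left (a * d) (b * c)
  have hr := le_max_right (a * d) (b * c)
  have hgeom : e * e ≤ 4 * max (a * d) (b * c) → f * f ≤ 4 * max (a * d) (b * c) →
      e * f ≤ 4 * max (a * d) (b * c) := fun h1 h2 => by nlinarith [sq_nonneg (e - f)]
  rcases two e1 with h1 | h1 <;> rcases two e2 with h2 | h2 <;> rcases two f1 with h3 | h3 <;>
    rcases two f2 with h4 | h4 <;>
  first
  | linarith [hmul hf ha h1 h4]
  | linarith [hmul hf hd h2 h3]
  | linarith [hmul hf hc h1 h3]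
  | linarith [hmul hf hb h2 h4]
  | exact hgeom (by linarith [hmul he ha h1 h2]) (by linarith [hmul hf hb h3 h4])
  | exact hgeom (by linarith [hmul he hc h1 h2]) (by linarith [hmul hf ha h3 h4])

theorem fourPoint_qhDist (hΩ : IsOpen Ω) (hne : Ωᶜ.Nonempty) (hH : ∀ e ∈ Ωᶜ, e.im ≤ 0)
    (harc : ∀ z ∈ Ω, ∀ w ∈ Ω, ∃ Γ, IsArc Ω z w Γ) :
    FourPoint (Ω ∩ {z | 0 ≤ z.im}) (qhDist Ω) 14 := by
  rintro x ⟨hx, hx0⟩ y ⟨hy, hy0⟩ z ⟨hz, hz0⟩ w ⟨hw, hw0⟩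
  have est := fun {u v : ℂ} hu hu0 hv hv0 =>
    qhDist_estimates (z := u) (w := v) hΩ hne hH harc hu hu0 hv hv0
  have hxz := (est hx hx0 hz hz0).2
  have hyw := (est hy hy0 hw hw0).2
  have hxy := (est hx hx0 hy hy0).1
  have hzw := (est hz hz0 hw hw0).1
  have hxw := (est hx hx0 hw hw0).1
  have hyz := (est hy hy0 hz hz0).1
  have pos := fun {u : ℂ} hu => infDist_compl_pos (z := u) hΩ hne hu
  have hx1 := pos hx
  have hy1 := pos hy
  have hz1 := pos hz
  have hw1 := pos hw
  have tri := fun u v t : ℂ => norm_sub_le_norm_sub_add_norm_sub u v t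
  have key := mul_le_four_mul_max
    (a := ‖x - y‖ + infDist x Ωᶜ + infDist y Ωᶜ) (b := ‖x - w‖ + infDist x Ωᶜ + infDist w Ωᶜ)
    (c := ‖y - z‖ + infDist y Ωᶜ + infDist z Ωᶜ) (d := ‖z - w‖ + infDist z Ωᶜ + infDist w Ωᶜ)
    (e := ‖x - z‖ + infDist x Ωᶜ + infDist z Ωᶜ) (f := ‖y - w‖ + infDist y Ωᶜ + infDist w Ωᶜ)
    (by positivity) (by positivity) (by positivity) (by positivity) (by positivity) (by positivity)
    (by linarith [tri x y z]) (by linarith [tri x w z, norm_sub_rev w z])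
    (by linarith [tri y x w, norm_sub_rev y x]) (by linarith [tri y z w])
  have l4 : Real.log 4 = 2 * Real.log 2 := by
    rw [show (4:ℝ) = 2 ^ 2 by norm_num, Real.log_pow]; norm_num
  have hl2 := Real.log_two_lt_d9
  have hlogmul : ∀ s t : ℝ, 0 < s → 0 < t →
      (‖x - z‖ + infDist x Ωᶜ + infDist z Ωᶜ) * (‖y - w‖ + infDist y Ωᶜ + infDist w Ωᶜ) ≤
        4 * (s * t) →
      Real.log (‖x - z‖ + infDist x Ωᶜ + infDist z Ωᶜ) +
        Real.log (‖y - w‖ + infDist y Ωᶜ + infDist w Ωᶜ) ≤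
        2 * Real.log 2 + Real.log s + Real.log t := fun s t hs ht h => by
    have := Real.log_le_log (by positivity) h
    rw [Real.log_mul (by positivity) (by positivity), Real.log_mul (by positivity) (by positivity),
      Real.log_mul hs.ne' ht.ne', l4] at this
    linarith
  rcases max_cases (α := ℝ) ((‖x - y‖ + infDist x Ωᶜ + infDist y Ωᶜ) *
    (‖z - w‖ + infDist z Ωᶜ + infDist w Ωᶜ)) ((‖x - w‖ + infDist x Ωᶜ + infDist w Ωᶜ) *
    (‖y - z‖ + infDist y Ωᶜ + infDist z Ωᶜ)) with h | h
  · rw [h.1] at key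
    have := hlogmul _ _ (by positivity) (by positivity) key
    have := le_max_left (qhDist Ω x y + qhDist Ω z w) (qhDist Ω x w + qhDist Ω y z)
    linarith
  · rw [h.1] at key
    have := hlogmul _ _ (by positivity) (by positivity) key
    have := le_max_right (qhDist Ω x y + qhDist Ω z w) (qhDist Ω x w + qhDist Ω y z)
    linarith

/-- Subarcs of real segments in `Ω` are rough geodesics. -/
theorem roughlyJoined_qhDist (hΩ : IsOpen Ω) (hne : Ωᶜ.Nonempty) (hH : ∀ e ∈ Ωᶜ, e.im = 0)
    (harc : ∀ z ∈ Ω, ∀ w ∈ Ω, ∃ Γ, IsArc Ω z w Γ) {p q : ℝ} (hpq : p ≤ q)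
    (hm : ∀ u ∈ Icc p q, (u : ℂ) ∈ Ω) :
    RoughlyJoined (Ω ∩ {z | z.im = 0}) (qhDist Ω) 2 p q := by
  have hp := infDist_compl_pos hΩ hne (hm p ⟨le_rfl, hpq⟩)
  have hq := infDist_compl_pos hΩ hne (hm q ⟨hpq, le_rfl⟩)
  have hlow := log_add_log_le_qhDist hΩ hne (harc p (hm p ⟨le_rfl, hpq⟩) q (hm q ⟨hpq, le_rfl⟩))
  set a := infDist (p:ℂ) Ωᶜ with ha
  set b := infDist (q:ℂ) Ωᶜ with hb
  have hnorm : ‖(p:ℂ) - q‖ = q - p := by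
    rw [← Complex.ofReal_sub, Complex.norm_real, Real.norm_eq_abs, abs_sub_comm,
      abs_of_nonneg (sub_nonneg.2 hpq)]
  rw [hnorm] at hlow
  have hcd : ContDiff ℝ 1 fun u : ℝ => (u : ℂ) := Complex.ofRealCLM.contDiff
  have hder : ∀ u, deriv (fun u : ℝ => (u : ℂ)) u = 1 := fun u =>
    (Complex.ofRealCLM.hasDerivAt (x := u)).deriv
  have hdist : ∀ s t : ℝ, p ≤ s → s ≤ t → t ≤ q →
      qhDist Ω s t ≤ ∫ u in s..t, qhDensity Ω (u : ℂ) := fun s t h1 h2 h3 => by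
    have := densityDist_le_integral (S := Ω) qhDensity_nonneg h2 hcd
      fun u hu => hm u ⟨h1.trans hu.1, hu.2.trans h3⟩
    simp only [hder, norm_one, mul_one] at this
    exact this
  have hInt : ∀ s ∈ Icc p q, ∀ t ∈ Icc p q, IntervalIntegrable (fun u : ℝ => qhDensity Ω (u : ℂ))
      MeasureTheory.volume s t := fun s hs t ht => by
    refine ContinuousOn.intervalIntegrable ?_
    exact (continuousOn_qhDensity hΩ hne).comp hcd.continuous.continuousOn
      fun u hu => hm u (uIcc_subset_Icc hs ht hu)
  have hpt : ∀ u ∈ Icc p q, qhDensity Ω (u : ℂ) ≤ 1 / (a + (u - p)) + 1 / (b + (q - u)) := by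
    intro u hu
    have h1 : 0 < a + (u - p) := by linarith [hu.1]
    have h2 : 0 < b + (q - u) := by linarith [hu.2]
    have hmin : min (a + (u - p)) (b + (q - u)) ≤ infDist (u:ℂ) Ωᶜ := by
      refine (le_infDist hne).2 fun e he => ?_
      have her : e = (e.re : ℂ) := Complex.ext rfl (by simp [hH e he])
      have hpe := infDist_le_dist_of_mem (x := (p:ℂ)) he
      have hqe := infDist_le_dist_of_mem (x := (q:ℂ)) he
      rw [← ha, her, Complex.dist_of_im_eq (by simp), Complex.ofReal_re, Complex.ofReal_re,
        Real.dist_eq] at hpe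
      rw [← hb, her, Complex.dist_of_im_eq (by simp), Complex.ofReal_re, Complex.ofReal_re,
        Real.dist_eq] at hqe
      rw [her, Complex.dist_of_im_eq (by simp), Complex.ofReal_re, Complex.ofReal_re,
        Real.dist_eq]
      have hne' : e.re < p ∨ q < e.re := by
        by_contra! hcon
        exact he (her ▸ hm _ hcon)
      rcases hne' with h | h
      · rw [abs_of_pos (by linarith)] at hpe
        rw [abs_of_pos (by linarith [hu.1])]
        exact (min_le_left _ _).trans (by linarith)
      · rw [abs_of_neg (by linarith)] at hqe
        rw [abs_of_neg (by linarith [hu.2])]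
        exact (min_le_right _ _).trans (by linarith)
    have h3 : (infDist (u:ℂ) Ωᶜ)⁻¹ ≤ (min (a + (u - p)) (b + (q - u)))⁻¹ :=
      inv_anti₀ (lt_min h1 h2) hmin
    refine h3.trans ?_
    rw [← one_div]
    rcases min_cases (a + (u - p)) (b + (q - u)) with h | h <;> rw [h.1]
    · linarith [one_div_pos.2 h2]
    · linarith [one_div_pos.2 h1]
  have hlen : ∫ u in p..q, qhDensity Ω (u : ℂ) ≤ qhDist Ω p q + 2 * Real.log 2 := by
    have hi1 : IntervalIntegrable (fun u => 1 / (a + (u - p)) + 1 / (b + (q - u)))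
        MeasureTheory.volume p q := by
      refine ContinuousOn.intervalIntegrable ?_
      rw [uIcc_of_le hpq]
      refine (continuousOn_const.div (by fun_prop) fun u hu => ?_).add
        (continuousOn_const.div (by fun_prop) fun u hu => ?_)
      · linarith [hu.1]
      · linarith [hu.2]
    have e := intervalIntegral.integral_eq_sub_of_hasDerivAt (a := p) (b := q)
      (f := fun u => Real.log (a + (u - p)) - Real.log (b + (q - u)))
      (f' := fun u => 1 / (a + (u - p)) + 1 / (b + (q - u))) (fun u hu => by
        rw [uIcc_of_le hpq] at hu
        have h1 := (((hasDerivAt_id u).sub_const p).const_add a).log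
          (by simp only [id]; linarith [hu.1])
        have h2 := (((hasDerivAt_id u).const_sub q).const_add b).log
          (by simp only [id]; linarith [hu.2])
        refine (h1.sub h2).congr_deriv ?_
        simp only [id]
        ring) hi1
    have h1 := intervalIntegral.integral_mono_on hpq
      (hInt p ⟨le_rfl, hpq⟩ q ⟨hpq, le_rfl⟩) hi1 hpt
    rw [e] at h1
    simp only [sub_self, add_zero] at h1
    have hstep : ∀ c, 0 < c → Real.log (c + (q - p)) - Real.log c ≤
        Real.log 2 + Real.log (1 + (q - p) / (2 * c)) := fun c hc => by
      have hqp := sub_nonneg.2 hpq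
      rw [← Real.log_div (by positivity) hc.ne', ← Real.log_mul two_ne_zero (by positivity)]
      refine Real.log_le_log (by positivity) ?_
      rw [add_div, div_self hc.ne', mul_add, mul_one]
      have : 2 * ((q - p) / (2 * c)) = (q - p) / c := by field_simp
      linarith
    linarith [hstep a hp, hstep b hq]
  intro t h0 ht
  obtain ⟨τ, hτ, hτt⟩ : t ∈ (fun s : ℝ => ∫ u in p..s, qhDensity Ω (u : ℂ)) '' Icc p q := by
    refine intermediate_value_Icc hpq ?_ ⟨by simpa using h0, ht.trans ?_⟩
    · have := intervalIntegral.continuousOn_primitive_interval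
        ((intervalIntegrable_iff' (a := p) (b := q)).1 (hInt p ⟨le_rfl, hpq⟩ q ⟨hpq, le_rfl⟩))
      rwa [uIcc_of_le hpq] at this
    · exact hdist p q le_rfl hpq le_rfl
  refine ⟨τ, ⟨hm τ hτ, by simp⟩, ?_, ?_⟩
  · have := hdist p τ le_rfl hτ.1 hτ.2
    simp only at hτt
    linarith
  · have e := intervalIntegral.integral_add_adjacent_intervals
      (hInt p ⟨le_rfl, hpq⟩ τ hτ) (hInt τ hτ q ⟨hpq, le_rfl⟩)
    have := hdist τ q hτ.1 hτ.2 le_rfl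
    simp only at hτt
    linarith [Real.log_two_lt_d9]

end Quasihyperbolic

section Cover

variable {Ω U : Set ℂ} {lam : ℂ → ℝ} {P : ℂ → ℂ}

/-- The open upper half plane as a subset of `ℂ`. -/
def upperHalf : Set ℂ := {z | 0 < z.im}

theorem isOpen_upperHalf : IsOpen upperHalf := isOpen_lt continuous_const continuous_im

theorem convex_upperHalf : Convex ℝ upperHalf := convex_halfSpace_im_gt 0

/-- A holomorphic continuous lift through a locally univalent map is holomorphic. -/
theorem differentiableOn_of_lift {p f g : ℂ → ℂ} {V : Set ℂ} (hV : IsOpen V) (hU : IsOpen U)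
    (hp : ∀ z ∈ V, DifferentiableAt ℂ p z) (hp' : ∀ z ∈ V, deriv p z ≠ 0)
    (hf : ContinuousOn f U) (hfV : MapsTo f U V) (hg : DifferentiableOn ℂ g U)
    (hpf : ∀ z ∈ U, p (f z) = g z) : DifferentiableOn ℂ f U := by
  intro z hz
  have hana : AnalyticAt ℂ p (f z) :=
    DifferentiableOn.analyticAt (fun v hv => (hp v hv).differentiableWithinAt)
      (hV.mem_nhds (hfV hz))
  have hs : HasStrictDerivAt p (deriv p (f z)) (f z) := hana.hasStrictDerivAt
  have hfc : ContinuousAt f z := hf.continuousAt (hU.mem_nhds hz)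
  have hinv := hs.to_localInverse (hf' := hp' _ (hfV hz))
  rw [hpf z hz] at hinv
  have hcomp : DifferentiableAt ℂ
      (HasStrictDerivAt.localInverse p _ _ hs (hp' _ (hfV hz)) ∘ g) z :=
    hinv.hasDerivAt.differentiableAt.comp z (hg.differentiableAt (hU.mem_nhds hz))
  refine (hcomp.congr_of_eventuallyEq ?_).differentiableWithinAt
  filter_upwards [hfc.eventually (hs.eventually_left_inverse (hf' := hp' _ (hfV hz))),
    hU.mem_nhds hz] with v hv hvU
  rw [Function.comp, ← hpf v hvU, hv]

/-- A holomorphic map `P` from the upper half plane onto `Ω` pulling the density `lam` back to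
the hyperbolic density, through which holomorphic maps on open star-shaped sets lift. -/
structure IsHalfPlaneCover (Ω : Set ℂ) (lam : ℂ → ℝ) (P : ℂ → ℂ) : Prop where
  differentiableOn : DifferentiableOn ℂ P upperHalf
  mapsTo : MapsTo P upperHalf Ω
  density : ∀ z ∈ upperHalf, lam (P z) * ‖deriv P z‖ = z.im⁻¹
  lift : ∀ (U : Set ℂ) (x₀ : ℂ) (g : ℂ → ℂ), IsOpen U → x₀ ∈ U → StarConvex ℝ x₀ U →
    DifferentiableOn ℂ g U → MapsTo g U Ω →
    ∃ f, DifferentiableOn ℂ f U ∧ MapsTo f U upperHalf ∧ ∀ z ∈ U, P (f z) = g z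

theorem IsPoincareDensity.exists_disc_lift {p : ℂ → ℂ}
    (hd : ∀ z ∈ ball (0:ℂ) 1, DifferentiableAt ℂ p z) (hd' : ∀ z ∈ ball (0:ℂ) 1, deriv p z ≠ 0)
    (him : p '' ball (0:ℂ) 1 = Ω) (hcov : IsCoveringMapOn (fun z : ball (0:ℂ) 1 => p z) Ω)
    {x₀ : ℂ} {g : ℂ → ℂ} (hU : IsOpen U) (hx₀ : x₀ ∈ U) (hst : StarConvex ℝ x₀ U)
    (hg : DifferentiableOn ℂ g U) (hgΩ : MapsTo g U Ω) :
    ∃ f, DifferentiableOn ℂ f U ∧ MapsTo f U (ball 0 1) ∧ ∀ z ∈ U, p (f z) = g z := by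
  have := hst.contractibleSpace ⟨x₀, hx₀⟩
  have := hU.locallyPathConnectedSpace
  obtain ⟨e, he, hpe⟩ : g x₀ ∈ p '' ball (0:ℂ) 1 := him ▸ hgΩ hx₀
  obtain ⟨F, ⟨-, hF⟩, -⟩ := hcov.existsUnique_continuousMap_lifts
    (A := U) ⟨U.domRestrict g, continuousOn_iff_continuous_domRestrict.mp hg.continuousOn⟩
    (a₀ := ⟨x₀, hx₀⟩) (e₀ := ⟨e, he⟩) hpe (fun a => hgΩ a.2)
  obtain ⟨f, hf⟩ : ∃ f : ℂ → ℂ, ∀ z : U, f z = F z := by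
    classical
    exact ⟨fun z => if hz : z ∈ U then F ⟨z, hz⟩ else 0, by simp⟩
  have hfU : MapsTo f U (ball 0 1) := fun z hz => by
    rw [hf ⟨z, hz⟩]; exact (F ⟨z, hz⟩).2
  have hpf : ∀ z ∈ U, p (f z) = g z := fun z hz => by
    rw [hf ⟨z, hz⟩]; exact congr_fun hF ⟨z, hz⟩
  have hfc : ContinuousOn f U := by
    rw [continuousOn_iff_continuous_domRestrict]
    have : U.domRestrict f = fun z => (F z : ℂ) := funext hf
    rw [this]
    exact continuous_subtype_val.comp F.continuous
  exact ⟨f, differentiableOn_of_lift isOpen_ball hU hd hd' hfc hfU hg hpf, hfU, hpf⟩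

theorem add_I_ne_zero {z : ℂ} (hz : z ∈ upperHalf) : z + I ≠ 0 := fun h => by
  have := congr_arg Complex.im h
  simp at this
  linarith [show 0 < z.im from hz]

theorem one_sub_norm_cayley_sq {z : ℂ} (hz : z ∈ upperHalf) :
    1 - ‖(z - I) / (z + I)‖ ^ 2 = 4 * z.im / ‖z + I‖ ^ 2 := by
  have h : ‖z + I‖ ≠ 0 := norm_ne_zero_iff.2 (add_I_ne_zero hz)
  rw [norm_div, div_pow]
  field_simp
  rw [Complex.sq_norm, Complex.sq_norm, Complex.normSq_apply, Complex.normSq_apply]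
  simp
  ring

theorem cayley_mem_ball {z : ℂ} (hz : z ∈ upperHalf) : (z - I) / (z + I) ∈ ball (0:ℂ) 1 := by
  have h : 0 < ‖z + I‖ := norm_pos_iff.2 (add_I_ne_zero hz)
  have hz' : 0 < z.im := hz
  have h1 := one_sub_norm_cayley_sq hz
  have h2 : 0 < 4 * z.im / ‖z + I‖ ^ 2 := by positivity
  rw [mem_ball_zero_iff]
  by_contra! hcon
  nlinarith

theorem IsPoincareDensity.exists_isHalfPlaneCover (h : IsPoincareDensity Ω lam) :
    ∃ P, IsHalfPlaneCover Ω lam P := by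
  obtain ⟨p, hd, him, hcov, hden⟩ := h
  have hd' : ∀ z ∈ ball (0:ℂ) 1, deriv p z ≠ 0 := fun z hz h0 => by
    have := hden z hz
    rw [h0, norm_zero, mul_zero] at this
    have hz1 : ‖z‖ < 1 := by simpa using hz
    have : 0 < 2 / (1 - ‖z‖ ^ 2) := div_pos two_pos (by nlinarith [norm_nonneg z])
    linarith
  have hc : ∀ z ∈ upperHalf, HasDerivAt (fun z => (z - I) / (z + I)) (2 * I / (z + I) ^ 2) z :=
    fun z hz => by
      refine (((hasDerivAt_id z).sub_const I).div ((hasDerivAt_id z).add_const I)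
        (add_I_ne_zero hz)).congr_deriv ?_
      simp only [id]
      ring
  refine ⟨fun z => p ((z - I) / (z + I)), fun z hz => ?_, fun z hz => ?_, fun z hz => ?_, ?_⟩
  · exact ((hd _ (cayley_mem_ball hz)).comp z (hc z hz).differentiableAt).differentiableWithinAt
  · exact him ▸ mem_image_of_mem p (cayley_mem_ball hz)
  · have hn : 0 < ‖z + I‖ := norm_pos_iff.2 (add_I_ne_zero hz)
    have hz' : 0 < z.im := hz
    have h1 := ((hd _ (cayley_mem_ball hz)).hasDerivAt.comp z (hc z hz)).deriv
    have h2 := hden _ (cayley_mem_ball hz)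
    rw [one_sub_norm_cayley_sq hz] at h2
    rw [Function.comp_def] at h1
    rw [h1, norm_mul, ← mul_assoc, h2, norm_div, norm_mul, norm_pow, Complex.norm_I]
    simp only [Complex.norm_ofNat]
    field_simp
    norm_num
  · intro U x₀ g hU hx₀ hst hg hgΩ
    obtain ⟨f, h1, h2, h3⟩ := exists_disc_lift hd hd' him hcov hU hx₀ hst hg hgΩ
    have hne : ∀ z ∈ U, 1 - f z ≠ 0 := fun z hz h0 => by
      have := h2 hz
      rw [← sub_eq_zero.1 h0] at this
      simp at this
    refine ⟨fun z => I * (1 + f z) / (1 - f z), ?_, fun z hz => ?_, fun z hz => ?_⟩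
    · exact ((h1.const_add 1).const_mul I).div (h1.const_sub 1) hne
    · have hlt : ‖f z‖ ^ 2 < 1 := by
        have : ‖f z‖ < 1 := by simpa using h2 hz
        nlinarith [norm_nonneg (f z)]
      have hpos : 0 < Complex.normSq (1 - f z) := Complex.normSq_pos.2 (hne z hz)
      have : (I * (1 + f z) / (1 - f z)).im = (1 - ‖f z‖ ^ 2) / Complex.normSq (1 - f z) := by
        rw [Complex.div_im, Complex.sq_norm, Complex.normSq_apply (f z)]
        simp
        ring
      show 0 < (I * (1 + f z) / (1 - f z)).im
      rw [this]
      exact div_pos (by linarith) hpos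
    · have h4 := hne z hz
      have h5 : (I * (1 + f z) / (1 - f z) - I) / (I * (1 + f z) / (1 - f z) + I) = f z := by
        have e1 : I * (1 + f z) / (1 - f z) - I = 2 * I * f z / (1 - f z) := by
          field_simp; ring
        have e2 : I * (1 + f z) / (1 - f z) + I = 2 * I / (1 - f z) := by
          field_simp; ring
        rw [e1, e2, div_div_div_cancel_right₀ h4, mul_div_cancel_left₀]
        simp
      simp only [h5, h3 z hz]

end Cover

section Symmetry

variable {S : Set ℂ} {ρ : ℂ → ℝ}

theorem densityDist_conj (hc : ContinuousOn ρ S) (hρ : ∀ z ∈ S, 0 ≤ ρ z)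
    (hS : ∀ z ∈ S, ∀ w ∈ S, ∃ Γ, IsArc S z w Γ)
    (hconj : ∀ z ∈ S, (starRingEnd ℂ) z ∈ S) (hρc : ∀ z ∈ S, ρ ((starRingEnd ℂ) z) = ρ z)
    {z w : ℂ} (hz : z ∈ S) (hw : w ∈ S) :
    densityDist S ρ ((starRingEnd ℂ) z) ((starRingEnd ℂ) w) = densityDist S ρ z w := by
  have key : ∀ z ∈ S, ∀ w ∈ S,
      densityDist S ρ ((starRingEnd ℂ) z) ((starRingEnd ℂ) w) ≤ densityDist S ρ z w := by
    intro z hz w hw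
    refine densityDist_comp_le hc hc hρ (hS z hz w hw) hconj fun Γ hΓ hm => ⟨?_, fun t => ?_⟩
    · exact Complex.conjCLE.contDiff.comp hΓ
    · have h1 : HasDerivAt (starRingEnd ℂ ∘ Γ) ((starRingEnd ℂ) (deriv Γ t)) t :=
        (Complex.conjCLE : ℂ →L[ℝ] ℂ).hasFDerivAt.comp_hasDerivAt t
          (hΓ.differentiable one_ne_zero t).hasDerivAt
      rw [h1.deriv, hρc _ (hm t), RCLike.norm_conj]
  refine le_antisymm (key z hz w hw) ?_
  simpa using key _ (hconj z hz) _ (hconj w hw)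

theorem FourPoint.of_approx {α : Type*} {S X Y : Set α} {d : α → α → ℝ} {δ ε : ℝ}
    (hd : IsPseudoDistOn S d) (hX : X ⊆ S) (hY : Y ⊆ S) (h : FourPoint Y d δ)
    (happ : ∀ x ∈ X, ∃ y ∈ Y, d x y ≤ ε) : FourPoint X d (δ + 8 * ε) := by
  have near : ∀ x ∈ S, ∀ x' ∈ S, ∀ y ∈ S, ∀ y' ∈ S, d x x' ≤ ε → d y y' ≤ ε →
      d x y ≤ d x' y' + 2 * ε ∧ d x' y' ≤ d x y + 2 * ε := by
    intro x hx x' hx' y hy y' hy' h1 h2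
    have t1 := hd.triangle x hx x' hx' y hy
    have t2 := hd.triangle x' hx' y' hy' y hy
    have t3 := hd.triangle x' hx' x hx y' hy'
    have t4 := hd.triangle x hx y hy y' hy'
    have s1 := hd.symm x hx x' hx'
    have s2 := hd.symm y hy y' hy'
    constructor <;> linarith
  intro x hx y hy z hz w hw
  obtain ⟨x', hx', ex⟩ := happ x hx
  obtain ⟨y', hy', ey⟩ := happ y hy
  obtain ⟨z', hz', ez⟩ := happ z hz
  obtain ⟨w', hw', ew⟩ := happ w hw
  have h4 := h x' hx' y' hy' z' hz' w' hw'
  have n1 := (near x (hX hx) x' (hY hx') z (hX hz) z' (hY hz') ex ez).1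
  have n2 := (near y (hX hy) y' (hY hy') w (hX hw) w' (hY hw') ey ew).1
  have n3 := (near x (hX hx) x' (hY hx') y (hX hy) y' (hY hy') ex ey).2
  have n4 := (near z (hX hz) z' (hY hz') w (hX hw) w' (hY hw') ez ew).2
  have n5 := (near x (hX hx) x' (hY hx') w (hX hw) w' (hY hw') ex ew).2
  have n6 := (near y (hX hy) y' (hY hy') z (hX hz) z' (hY hz') ey ez).2
  have m1 := le_max_left (d x y + d z w) (d x w + d y z)
  have m2 := le_max_right (d x y + d z w) (d x w + d y z)
  rcases max_choice (d x' y' + d z' w') (d x' w' + d y' z') with h5 | h5 <;> rw [h5] at h4 <;>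
    linarith

end Symmetry

section UpperHalf

theorem infDist_compl_upperHalf {z : ℂ} (hz : z ∈ upperHalf) : infDist z upperHalfᶜ = z.im := by
  have hre : (z.re : ℂ) ∈ upperHalfᶜ := by simp [upperHalf]
  refine le_antisymm ((infDist_le_dist_of_mem hre).trans_eq ?_)
    (im_le_infDist ⟨_, hre⟩ fun e he => not_lt.1 he)
  rw [Complex.dist_of_re_eq (by simp), Complex.ofReal_im, Real.dist_0_eq_abs, abs_of_pos hz]

theorem nonempty_compl_upperHalf : upperHalfᶜ.Nonempty := ⟨0, by simp [upperHalf]⟩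

theorem continuousOn_qhDensity_upperHalf : ContinuousOn (qhDensity upperHalf) upperHalf :=
  continuousOn_qhDensity isOpen_upperHalf nonempty_compl_upperHalf

theorem exists_isArc_upperHalf : ∀ z ∈ upperHalf, ∀ w ∈ upperHalf, ∃ Γ, IsArc upperHalf z w Γ :=
  fun _ hz _ hw => exists_isArc_segment (convex_upperHalf.segment_subset hz hw)

theorem isPseudoDistOn_upperHalf : IsPseudoDistOn upperHalf (qhDist upperHalf) :=
  isPseudoDistOn_densityDist continuousOn_qhDensity_upperHalf qhDensity_nonneg
    exists_isArc_upperHalf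

theorem fourPoint_upperHalf : FourPoint upperHalf (qhDist upperHalf) 14 := by
  have h := fourPoint_qhDist isOpen_upperHalf nonempty_compl_upperHalf
    (fun e he => not_lt.1 he) exists_isArc_upperHalf
  have e : upperHalf ∩ {z : ℂ | 0 ≤ z.im} = upperHalf :=
    inter_eq_left.2 fun z hz => le_of_lt (show 0 < z.im from hz)
  rwa [e] at h

/-- The Schwarz–Pick lemma for the upper half plane. -/
theorem norm_deriv_mul_im_le {f : ℂ → ℂ} (hf : DifferentiableOn ℂ f upperHalf)
    (hm : MapsTo f upperHalf upperHalf) {z : ℂ} (hz : z ∈ upperHalf) :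
    ‖deriv f z‖ * z.im ≤ (f z).im := by
  have hz0 : 0 < z.im := hz
  have hw0 : 0 < (f z).im := hm hz
  have h1ne : ∀ ζ ∈ ball (0:ℂ) 1, 1 - ζ ≠ 0 := fun ζ hζ h0 => by
    rw [← sub_eq_zero.1 h0] at hζ
    simp at hζ
  have hψm : ∀ ζ ∈ ball (0:ℂ) 1, (z - (starRingEnd ℂ) z * ζ) / (1 - ζ) ∈ upperHalf := by
    intro ζ hζ
    have hlt : ‖ζ‖ ^ 2 < 1 := by
      have : ‖ζ‖ < 1 := by simpa using hζ
      nlinarith [norm_nonneg ζ]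
    have hpos := Complex.normSq_pos.2 (h1ne ζ hζ)
    have e : ((z - (starRingEnd ℂ) z * ζ) / (1 - ζ)).im =
        z.im * (1 - ‖ζ‖ ^ 2) / Complex.normSq (1 - ζ) := by
      rw [Complex.div_im, Complex.sq_norm, Complex.normSq_apply ζ]
      simp
      ring
    show 0 < ((z - (starRingEnd ℂ) z * ζ) / (1 - ζ)).im
    rw [e]
    exact div_pos (mul_pos hz0 (by linarith)) hpos
  have hψd : ∀ ζ ∈ ball (0:ℂ) 1, HasDerivAt (fun ζ => (z - (starRingEnd ℂ) z * ζ) / (1 - ζ))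
      ((z - (starRingEnd ℂ) z) / (1 - ζ) ^ 2) ζ := fun ζ hζ => by
    refine ((((hasDerivAt_id ζ).const_mul ((starRingEnd ℂ) z)).const_sub z).div
      ((hasDerivAt_id ζ).const_sub 1) (h1ne ζ hζ)).congr_deriv ?_
    simp only [id]
    ring
  have hφne : ∀ w ∈ upperHalf, w - (starRingEnd ℂ) (f z) ≠ 0 := fun w hw h0 => by
    have := congr_arg Complex.im h0
    simp at this
    linarith [show 0 < w.im from hw]
  have hφd : ∀ w ∈ upperHalf, HasDerivAt (fun w => (w - f z) / (w - (starRingEnd ℂ) (f z)))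
      ((f z - (starRingEnd ℂ) (f z)) / (w - (starRingEnd ℂ) (f z)) ^ 2) w := fun w hw => by
    refine (((hasDerivAt_id w).sub_const (f z)).div
      ((hasDerivAt_id w).sub_const ((starRingEnd ℂ) (f z))) (hφne w hw)).congr_deriv ?_
    simp only [id]
    ring
  have hφm : ∀ w ∈ upperHalf, (w - f z) / (w - (starRingEnd ℂ) (f z)) ∈ closedBall (0:ℂ) 1 := by
    intro w hw
    have hw' : 0 < w.im := hw
    rw [mem_closedBall_zero_iff, norm_div]
    refine div_le_one_of_le₀ ?_ (norm_nonneg _)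
    rw [← abs_norm, ← abs_norm (w - (starRingEnd ℂ) (f z)), ← sq_le_sq, Complex.sq_norm,
      Complex.sq_norm, Complex.normSq_apply, Complex.normSq_apply]
    simp
    nlinarith [mul_pos hw' hw0]
  have hψ0 : (z - (starRingEnd ℂ) z * 0) / (1 - 0) = z := by simp
  set h : ℂ → ℂ := fun ζ => (f ((z - (starRingEnd ℂ) z * ζ) / (1 - ζ)) - f z) /
    (f ((z - (starRingEnd ℂ) z * ζ) / (1 - ζ)) - (starRingEnd ℂ) (f z)) with hh
  have hfd : ∀ v ∈ upperHalf, HasDerivAt f (deriv f v) v := fun v hv =>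
    (hf.differentiableAt (isOpen_upperHalf.mem_nhds hv)).hasDerivAt
  have hhd : ∀ ζ ∈ ball (0:ℂ) 1, HasDerivAt h ((f z - (starRingEnd ℂ) (f z)) /
      (f ((z - (starRingEnd ℂ) z * ζ) / (1 - ζ)) - (starRingEnd ℂ) (f z)) ^ 2 *
        (deriv f ((z - (starRingEnd ℂ) z * ζ) / (1 - ζ)) *
          ((z - (starRingEnd ℂ) z) / (1 - ζ) ^ 2))) ζ := fun ζ hζ =>
    HasDerivAt.comp (h₂ := fun w => (w - f z) / (w - (starRingEnd ℂ) (f z))) ζ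
      (hφd _ (hm (hψm ζ hζ))) (HasDerivAt.comp (h₂ := f) ζ (hfd _ (hψm ζ hζ)) (hψd ζ hζ))
  have h00 : h 0 = 0 := by simp [hh]
  have hsch := Complex.norm_deriv_le_one_of_mapsTo_ball (f := h) (c := 0) (R := 1)
    (fun ζ hζ => (hhd ζ hζ).differentiableAt.differentiableWithinAt)
    (fun ζ hζ => by rw [h00]; exact hφm _ (hm (hψm ζ hζ))) one_pos
  rw [(hhd 0 (by simp)).deriv, hψ0] at hsch
  have hsub : ∀ v : ℂ, v - (starRingEnd ℂ) v = (2 * v.im : ℝ) * I := fun v => by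
    rw [Complex.sub_conj]
  rw [hsub, hsub, norm_mul, norm_mul, norm_div, norm_div, norm_pow, norm_mul, norm_mul,
    Complex.norm_I, Complex.norm_real, Complex.norm_real, Real.norm_of_nonneg (by positivity),
    Real.norm_of_nonneg (by positivity)] at hsch
  simp only [sub_zero, norm_one, one_pow, div_one, mul_one] at hsch
  rw [pow_two, div_mul_cancel_left₀ (by positivity), inv_mul_le_iff₀ (by positivity)] at hsch
  linarith

end UpperHalf

section CoverMetric

variable {Ω U : Set ℂ} {lam : ℂ → ℝ} {P : ℂ → ℂ}

namespace IsHalfPlaneCover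

theorem deriv_ne_zero (hP : IsHalfPlaneCover Ω lam P) {z : ℂ} (hz : z ∈ upperHalf) :
    deriv P z ≠ 0 := fun h0 => by
  have := hP.density z hz
  rw [h0, norm_zero, mul_zero] at this
  exact (inv_pos.2 (show 0 < z.im from hz)).ne this

/-- Inverse branches of the covering on star-shaped sets. -/
theorem exists_section (hP : IsHalfPlaneCover Ω lam P) (hU : IsOpen U) {x₀ : ℂ} (hx₀ : x₀ ∈ U)
    (hst : StarConvex ℝ x₀ U) (hUΩ : U ⊆ Ω) :
    ∃ s, DifferentiableOn ℂ s U ∧ MapsTo s U upperHalf ∧ (∀ z ∈ U, P (s z) = z) ∧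
      ∀ z ∈ U, lam z = (s z).im⁻¹ * ‖deriv s z‖ := by
  obtain ⟨s, h1, h2, h3⟩ := hP.lift U x₀ id hU hx₀ hst differentiableOn_id hUΩ
  refine ⟨s, h1, h2, h3, fun z hz => ?_⟩
  have hs := (h1.differentiableAt (hU.mem_nhds hz)).hasDerivAt
  have hp := (hP.differentiableOn.differentiableAt (isOpen_upperHalf.mem_nhds (h2 hz))).hasDerivAt
  have hid : HasDerivAt (P ∘ s) 1 z := by
    refine (hasDerivAt_id z).congr_of_eventuallyEq ?_
    filter_upwards [hU.mem_nhds hz] with v hv using h3 v hv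
  have e := (hp.comp z hs).unique hid
  have e2 := hP.density _ (h2 hz)
  rw [← e2, mul_assoc, ← norm_mul, e, norm_one, mul_one, h3 z hz, id]

theorem exists_local_section (hP : IsHalfPlaneCover Ω lam P) (hΩ : IsOpen Ω) {z : ℂ}
    (hz : z ∈ Ω) : ∃ U s, IsOpen U ∧ z ∈ U ∧ DifferentiableOn ℂ s U ∧ MapsTo s U upperHalf ∧
      (∀ z ∈ U, P (s z) = z) ∧ ∀ z ∈ U, lam z = (s z).im⁻¹ * ‖deriv s z‖ := by
  obtain ⟨ε, hε, hball⟩ := Metric.isOpen_iff.1 hΩ z hz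
  obtain ⟨s, h⟩ := hP.exists_section isOpen_ball (mem_ball_self hε)
    ((convex_ball z ε).starConvex (mem_ball_self hε)) hball
  exact ⟨ball z ε, s, isOpen_ball, mem_ball_self hε, h⟩

theorem density_nonneg (hP : IsHalfPlaneCover Ω lam P) (hΩ : IsOpen Ω) :
    ∀ z ∈ Ω, 0 ≤ lam z := fun z hz => by
  obtain ⟨U, s, -, hzU, -, h2, -, h4⟩ := hP.exists_local_section hΩ hz
  rw [h4 z hzU]
  exact mul_nonneg (inv_nonneg.2 (le_of_lt (show 0 < (s z).im from h2 hzU))) (norm_nonneg _)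

theorem continuousOn_density (hP : IsHalfPlaneCover Ω lam P) (hΩ : IsOpen Ω) :
    ContinuousOn lam Ω := fun z hz => by
  obtain ⟨U, s, hU, hzU, h1, h2, -, h4⟩ := hP.exists_local_section hΩ hz
  have hc : ContinuousOn (fun z => (s z).im⁻¹ * ‖deriv s z‖) U :=
    ((continuous_im.comp_continuousOn h1.continuousOn).inv₀
      fun v hv => ne_of_gt (show 0 < (s v).im from h2 hv)).mul (h1.deriv hU).continuousOn.norm
  exact ((hc.congr h4).continuousAt (hU.mem_nhds hzU)).continuousWithinAt

theorem density_conj_le (hP : IsHalfPlaneCover Ω lam P) (hΩ : IsOpen Ω)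
    (hconj : ∀ z ∈ Ω, (starRingEnd ℂ) z ∈ Ω) {v : ℂ} (hv : v ∈ Ω) :
    lam ((starRingEnd ℂ) v) ≤ lam v := by
  obtain ⟨U, s, -, hvU, -, h2, h3, -⟩ := hP.exists_local_section hΩ hv
  have hz := h2 hvU
  have hPz := h3 v hvU
  set z := s v with hz_def
  have hneg : ∀ ζ ∈ upperHalf, -(starRingEnd ℂ) ζ ∈ upperHalf := fun ζ hζ => by
    simpa [upperHalf] using hζ
  have hgd : ∀ ζ ∈ upperHalf, HasDerivAt (fun ζ => (starRingEnd ℂ) (P (-(starRingEnd ℂ) ζ)))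
      ((starRingEnd ℂ) (-deriv P (-(starRingEnd ℂ) ζ))) ζ := fun ζ hζ => by
    have h := (hP.differentiableOn.differentiableAt
      (isOpen_upperHalf.mem_nhds (hneg ζ hζ))).hasDerivAt
    have h' : HasDerivAt (fun ξ => P (-ξ)) (-deriv P (-(starRingEnd ℂ) ζ))
        ((starRingEnd ℂ) ζ) :=
      (HasDerivAt.comp (h₂ := P) _ h (hasDerivAt_neg ((starRingEnd ℂ) ζ))).congr_deriv
        (mul_neg_one _)
    have h'' := h'.conj_conj
    rw [Complex.conj_conj] at h''
    exact h''
  have hI : I ∈ upperHalf := by simp [upperHalf]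
  obtain ⟨f, f1, f2, f3⟩ := hP.lift upperHalf I
    (fun ζ => (starRingEnd ℂ) (P (-(starRingEnd ℂ) ζ))) isOpen_upperHalf hI
    (convex_upperHalf.starConvex hI)
    (fun ζ hζ => (hgd ζ hζ).differentiableAt.differentiableWithinAt)
    fun ζ hζ => hconj _ (hP.mapsTo (hneg ζ hζ))
  have hζ := hneg z hz
  set ζ := -(starRingEnd ℂ) z with hζ_def
  have hζz : -(starRingEnd ℂ) ζ = z := by simp [hζ_def]
  have hfd := (f1.differentiableAt (isOpen_upperHalf.mem_nhds hζ)).hasDerivAt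
  have hPd := (hP.differentiableOn.differentiableAt
    (isOpen_upperHalf.mem_nhds (f2 hζ))).hasDerivAt
  have hcomp : HasDerivAt (P ∘ f) ((starRingEnd ℂ) (-deriv P (-(starRingEnd ℂ) ζ))) ζ := by
    refine (hgd ζ hζ).congr_of_eventuallyEq ?_
    filter_upwards [isOpen_upperHalf.mem_nhds hζ] with ξ hξ using f3 ξ hξ
  have e1 := congr_arg norm ((hPd.comp ζ hfd).unique hcomp)
  rw [norm_mul, RCLike.norm_conj, norm_neg, hζz] at e1
  have e2 := hP.density _ (f2 hζ)
  rw [f3 ζ hζ, hζz, hPz] at e2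
  have e3 := hP.density z hz
  rw [hPz] at e3
  have e4 := norm_deriv_mul_im_le f1 f2 hζ
  have hfi : 0 < (f ζ).im := f2 hζ
  have hzi : 0 < z.im := hz
  have e5 : ζ.im = z.im := by simp [hζ_def]
  have hpos : 0 < ‖deriv P z‖ := norm_pos_iff.2 (hP.deriv_ne_zero hz)
  refine le_of_mul_le_mul_right ?_ hpos
  rw [e3, ← e1, ← mul_assoc, e2, ← div_eq_inv_mul, ← one_div, div_le_div_iff₀ hfi hzi, one_mul]
  rwa [e5] at e4

theorem density_conj (hP : IsHalfPlaneCover Ω lam P) (hΩ : IsOpen Ω)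
    (hconj : ∀ z ∈ Ω, (starRingEnd ℂ) z ∈ Ω) {v : ℂ} (hv : v ∈ Ω) :
    lam ((starRingEnd ℂ) v) = lam v :=
  le_antisymm (hP.density_conj_le hΩ hconj hv)
    (by simpa using hP.density_conj_le hΩ hconj (hconj v hv))

theorem densityDist_le_qhDist (hP : IsHalfPlaneCover Ω lam P) (hΩ : IsOpen Ω) {a b : ℂ}
    (ha : a ∈ upperHalf) (hb : b ∈ upperHalf) :
    densityDist Ω lam (P a) (P b) ≤ qhDist upperHalf a b := by
  refine densityDist_comp_le continuousOn_qhDensity_upperHalf (hP.continuousOn_density hΩ)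
    (hP.density_nonneg hΩ) (exists_isArc_upperHalf a ha b hb) hP.mapsTo
    fun Γ hΓ hm => ⟨?_, fun t => ?_⟩
  · have : ContDiffOn ℂ 1 P upperHalf := hP.differentiableOn.contDiffOn isOpen_upperHalf
    rw [← contDiffOn_univ]
    exact (this.restrict_scalars ℝ).comp hΓ.contDiffOn fun t _ => hm t
  · have h1 := (hP.differentiableOn.differentiableAt
      (isOpen_upperHalf.mem_nhds (hm t))).hasDerivAt
    have h2 := h1.scomp t (hΓ.differentiable one_ne_zero t).hasDerivAt
    rw [h2.deriv, norm_smul, mul_comm ‖deriv Γ t‖, ← mul_assoc, hP.density _ (hm t), qhDensity,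
      infDist_compl_upperHalf (hm t)]

end IsHalfPlaneCover

end CoverMetric

section Fold

/-- The smoothed folding of a curve into a closed half plane, the upper one for `σ = 1` and the
lower one for `σ = -1`. -/
noncomputable def foldCurve (Γ : ℝ → ℂ) (σ ε t : ℝ) : ℂ :=
  ((Γ t).re : ℂ) + ((σ * √((Γ t).im ^ 2 + ε ^ 2) : ℝ) : ℂ) * I

variable {Γ : ℝ → ℂ} {σ : ℝ}

theorem foldCurve_im (Γ : ℝ → ℂ) (σ ε t : ℝ) :
    (foldCurve Γ σ ε t).im = σ * √((Γ t).im ^ 2 + ε ^ 2) := by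
  simp [foldCurve]

theorem continuous_foldCurve (hΓ : Continuous Γ) (σ : ℝ) :
    Continuous fun q : ℝ × ℝ => foldCurve Γ σ q.1 q.2 := by
  unfold foldCurve
  fun_prop

theorem foldCurve_zero (h : σ ^ 2 = 1) (t : ℝ) :
    foldCurve Γ σ 0 t = Γ t ∨ foldCurve Γ σ 0 t = (starRingEnd ℂ) (Γ t) := by
  have e : foldCurve Γ σ 0 t = ((Γ t).re : ℂ) + ((σ * |(Γ t).im| : ℝ) : ℂ) * I := by
    simp [foldCurve, Real.sqrt_sq_eq_abs]
  have key : σ * |(Γ t).im| = (Γ t).im ∨ σ * |(Γ t).im| = -(Γ t).im := by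
    rcases mul_self_eq_one_iff.1 ((pow_two σ).symm.trans h) with rfl | rfl <;>
      rcases abs_choice (Γ t).im with h | h <;> rw [h] <;> simp
  rw [e]
  rcases key with h | h <;> rw [h]
  · exact Or.inl (re_add_im _)
  · right
    apply Complex.ext <;> simp

theorem foldCurve_zero_of_nonneg (h : σ ^ 2 = 1) {t : ℝ} (ht : 0 ≤ σ * (Γ t).im) :
    foldCurve Γ σ 0 t = Γ t := by
  have e : σ * |(Γ t).im| = (Γ t).im := by
    have : |σ| = 1 := by rw [← abs_one, ← sq_eq_sq_iff_abs_eq_abs, h, one_pow]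
    rw [← one_mul |(Γ t).im|, ← this, ← abs_mul, abs_of_nonneg ht, ← mul_assoc, ← pow_two, h,
      one_mul]
  rw [foldCurve, zero_pow two_ne_zero, add_zero, Real.sqrt_sq_eq_abs, e, re_add_im]

theorem hasDerivAt_foldCurve (hΓ : ContDiff ℝ 1 Γ) (σ : ℝ) {ε : ℝ} (hε : ε ≠ 0) (t : ℝ) :
    HasDerivAt (foldCurve Γ σ ε) (((deriv Γ t).re : ℂ) +
      ((σ * ((Γ t).im * (deriv Γ t).im / √((Γ t).im ^ 2 + ε ^ 2)) : ℝ) : ℂ) * I) t := by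
  have h := (hΓ.differentiable one_ne_zero t).hasDerivAt
  have hre : HasDerivAt (fun t => (Γ t).re) (deriv Γ t).re t :=
    Complex.reCLM.hasFDerivAt.comp_hasDerivAt t h
  have him : HasDerivAt (fun t => (Γ t).im) (deriv Γ t).im t :=
    Complex.imCLM.hasFDerivAt.comp_hasDerivAt t h
  have hsq : HasDerivAt (fun t => σ * √((Γ t).im ^ 2 + ε ^ 2)) _ t :=
    (HasDerivAt.sqrt ((him.pow 2).add_const (ε ^ 2))
      (show (Γ t).im ^ 2 + ε ^ 2 ≠ 0 by positivity)).const_mul σ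
  refine (hre.ofReal_comp.add (hsq.ofReal_comp.mul_const I)).congr_deriv ?_
  congr 4
  simp only [Pi.pow_apply]
  push_cast
  rw [mul_assoc 2, mul_div_mul_left _ _ two_ne_zero, pow_one]

theorem contDiff_foldCurve (hΓ : ContDiff ℝ 1 Γ) (σ : ℝ) {ε : ℝ} (hε : ε ≠ 0) :
    ContDiff ℝ 1 (foldCurve Γ σ ε) := by
  have hre : ContDiff ℝ 1 fun t => (Γ t).re := Complex.reCLM.contDiff.comp hΓ
  have him : ContDiff ℝ 1 fun t => (Γ t).im := Complex.imCLM.contDiff.comp hΓ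
  have hsq : ContDiff ℝ 1 fun t => σ * √((Γ t).im ^ 2 + ε ^ 2) :=
    contDiff_const.mul (((him.pow 2).add contDiff_const).sqrt fun t => by positivity)
  exact (Complex.ofRealCLM.contDiff.comp hre).add
    ((Complex.ofRealCLM.contDiff.comp hsq).mul contDiff_const)

theorem norm_deriv_foldCurve_le (hΓ : ContDiff ℝ 1 Γ) (h : σ ^ 2 = 1) {ε : ℝ} (hε : ε ≠ 0)
    (t : ℝ) : ‖deriv (foldCurve Γ σ ε) t‖ ≤ ‖deriv Γ t‖ := by
  rw [(hasDerivAt_foldCurve hΓ σ hε t).deriv, ← abs_norm, ← abs_norm (deriv Γ t), ← sq_le_sq,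
    Complex.sq_norm, Complex.sq_norm, Complex.normSq_add_mul_I, Complex.normSq_apply, mul_pow, h,
    one_mul, div_pow, mul_pow, Real.sq_sqrt (by positivity), ← pow_two, ← pow_two]
  refine add_le_add le_rfl (div_le_of_le_mul₀ (by positivity) (by positivity) ?_)
  nlinarith [mul_nonneg (sq_nonneg (deriv Γ t).im) (sq_nonneg ε)]

end Fold

section Slit

variable {Ω : Set ℂ} {J : Set ℝ}

theorem isOpen_slit (hJ : IsOpen J) : IsOpen {z : ℂ | z.im ≠ 0 ∨ z.re ∈ J} :=
  (isOpen_ne_fun continuous_im continuous_const).union (hJ.preimage continuous_re)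

theorem starConvex_slit (hJ : J.OrdConnected) {c : ℝ} (hc : c ∈ J) :
    StarConvex ℝ (c : ℂ) {z : ℂ | z.im ≠ 0 ∨ z.re ∈ J} := by
  rintro z (hz | hz) a b ha hb hab
  · rcases eq_or_ne b 0 with rfl | hb0
    · right
      have : a = 1 := by linarith
      simpa [this] using hc
    · left
      simpa [hb0] using hz
  · right
    simpa using hJ.convex hc hz ha hb hab

theorem slit_subset (hH : ∀ z : ℂ, z.im ≠ 0 → z ∈ Ω) (hJΩ : ∀ x ∈ J, (x : ℂ) ∈ Ω) :
    {z : ℂ | z.im ≠ 0 ∨ z.re ∈ J} ⊆ Ω := fun z hz => by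
  by_cases h : z.im = 0
  · have e : z = (z.re : ℂ) := Complex.ext (by simp) (by simp [h])
    rw [e]
    exact hJΩ _ (hz.resolve_left (not_not.2 h))
  · exact hH z h

end Slit

section CoverMetric

variable {Ω V : Set ℂ} {lam : ℂ → ℝ} {P s : ℂ → ℂ} {σ : ℝ}

namespace IsHalfPlaneCover

theorem qhDist_section_le (hP : IsHalfPlaneCover Ω lam P) (hΩ : IsOpen Ω)
    (hconj : ∀ z ∈ Ω, (starRingEnd ℂ) z ∈ Ω) (harc : ∀ z ∈ Ω, ∀ w ∈ Ω, ∃ Γ, IsArc Ω z w Γ)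
    (hV : IsOpen V) (hVΩ : V ⊆ Ω) (hVim : ∀ z : ℂ, z.im ≠ 0 → z ∈ V)
    (hs : DifferentiableOn ℂ s V) (hsm : MapsTo s V upperHalf)
    (hsl : ∀ z ∈ V, lam z = (s z).im⁻¹ * ‖deriv s z‖) (hσ : σ ^ 2 = 1) {z w : ℂ}
    (hz : z ∈ V) (hw : w ∈ V) (hz0 : 0 ≤ σ * z.im) (hw0 : 0 ≤ σ * w.im) :
    qhDist upperHalf (s z) (s w) ≤ densityDist Ω lam z w + 2 := by
  have hc := hP.continuousOn_density hΩ
  rw [← sub_le_iff_le_add]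
  refine le_densityDist hc (harc z (hVΩ hz) w (hVΩ hw)) fun Γ hΓ => ?_
  rw [sub_le_iff_le_add]
  have h0 : Γ 0 = z := hΓ.left 0 le_rfl
  have h1 : Γ 1 = w := hΓ.right 1 le_rfl
  have hFV : ∀ ε : ℝ, ε ≠ 0 → ∀ t, foldCurve Γ σ ε t ∈ V := fun ε hε t => hVim _ <| by
    rw [foldCurve_im]
    have : σ ≠ 0 := fun h => by simp [h] at hσ
    positivity
  have hFΩ : ∀ ε t, foldCurve Γ σ ε t ∈ Ω := fun ε t => by
    rcases eq_or_ne ε 0 with rfl | hε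
    · rcases foldCurve_zero (Γ := Γ) hσ t with h | h <;> rw [h]
      exacts [hΓ.mem t, hconj _ (hΓ.mem t)]
    · exact hVΩ (hFV ε hε t)
  have hFc := continuous_foldCurve hΓ.contDiff.continuous σ
  have hsd : ∀ v ∈ V, HasDerivAt s (deriv s v) v := fun v hv =>
    (hs.differentiableAt (hV.mem_nhds hv)).hasDerivAt
  have hd'c : Continuous fun t => ‖deriv Γ t‖ := (hΓ.contDiff.continuous_deriv le_rfl).norm
  have hGc : Continuous fun q : ℝ × ℝ => lam (foldCurve Γ σ q.1 q.2) * ‖deriv Γ q.2‖ :=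
    (hc.comp_continuous hFc fun q => hFΩ q.1 q.2).mul (hd'c.comp continuous_snd)
  have hlim : Tendsto (fun ε => ∫ t in (0:ℝ)..1, lam (foldCurve Γ σ ε t) * ‖deriv Γ t‖)
      (nhds 0) (nhds (curveLen lam Γ)) := by
    have h := (intervalIntegral.continuous_parametric_intervalIntegral_of_continuous'
      (μ := MeasureTheory.volume)
      (f := fun ε t => lam (foldCurve Γ σ ε t) * ‖deriv Γ t‖) hGc 0 1).tendsto 0
    refine h.trans_eq ?_
    congr 1
    refine intervalIntegral.integral_congr fun t _ => ?_
    rcases foldCurve_zero (Γ := Γ) hσ t with h | h <;> simp only [h]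
    rw [hP.density_conj hΩ hconj (hΓ.mem t)]
  have hcurve : ∀ ε : ℝ, ε ≠ 0 →
      qhDist upperHalf (s (foldCurve Γ σ ε 0)) (s (foldCurve Γ σ ε 1)) ≤
        ∫ t in (0:ℝ)..1, lam (foldCurve Γ σ ε t) * ‖deriv Γ t‖ := fun ε hε => by
    have hF1 := contDiff_foldCurve hΓ.contDiff σ hε
    have hF2 := hFV ε hε
    have hsF : ContDiff ℝ 1 (s ∘ foldCurve Γ σ ε) := by
      have : ContDiffOn ℂ 1 s V := hs.contDiffOn hV
      rw [← contDiffOn_univ]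
      exact (this.restrict_scalars ℝ).comp hF1.contDiffOn fun t _ => hF2 t
    refine (densityDist_le_integral qhDensity_nonneg zero_le_one hsF
      fun t _ => hsm (hF2 t)).trans ?_
    refine intervalIntegral.integral_mono_on zero_le_one
      ((continuous_integrand continuousOn_qhDensity_upperHalf hsF
        fun t => hsm (hF2 t)).intervalIntegrable _ _)
      ((hGc.comp (Continuous.prodMk_right ε)).intervalIntegrable _ _) fun t _ => ?_
    have h2 := (hsd _ (hF2 t)).scomp t (hF1.differentiable one_ne_zero t).hasDerivAt
    rw [h2.deriv, norm_smul, qhDensity, Function.comp_apply,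
      infDist_compl_upperHalf (hsm (hF2 t)), hsl _ (hF2 t), mul_comm ‖deriv _ t‖, ← mul_assoc]
    exact mul_le_mul_of_nonneg_left (norm_deriv_foldCurve_le hΓ.contDiff hσ hε t)
      (mul_nonneg (inv_nonneg.2 (le_of_lt (show 0 < (s _).im from hsm (hF2 t)))) (norm_nonneg _))
  have hnear : ∀ t v, Γ t = v → v ∈ V → 0 ≤ σ * v.im →
      ∀ᶠ ε in nhdsWithin (0:ℝ) {0}ᶜ, qhDist upperHalf (s v) (s (foldCurve Γ σ ε t)) ≤ 1 := by
    rintro t v rfl hv hv0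
    have h := eventually_densityDist_le_one isOpen_upperHalf continuousOn_qhDensity_upperHalf
      qhDensity_nonneg (hsm hv)
    have hF : Tendsto (fun ε => foldCurve Γ σ ε t) (nhds 0) (nhds (Γ t)) := by
      have := (hFc.comp (Continuous.prodMk_left t)).tendsto 0
      simpa [Function.comp_def, foldCurve_zero_of_nonneg hσ hv0] using this
    exact ((((hsd _ hv).continuousAt.tendsto).comp hF).eventually h).filter_mono
      nhdsWithin_le_nhds
  have hlim' := (hlim.mono_left (nhdsWithin_le_nhds (s := {0}ᶜ))).add_const 2
  refine ge_of_tendsto hlim' ?_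
  filter_upwards [hnear 0 z h0 hz hz0, hnear 1 w h1 hw hw0, self_mem_nhdsWithin] with ε e0 e1 hε
  have hd := isPseudoDistOn_upperHalf
  have m0 := hsm (hFV ε hε 0)
  have m1 := hsm (hFV ε hε 1)
  have t1 := hd.triangle _ (hsm hz) _ m0 _ (hsm hw)
  have t2 := hd.triangle _ m0 _ m1 _ (hsm hw)
  rw [hd.symm _ m1 _ (hsm hw)] at t2
  have := hcurve ε hε
  linarith

theorem fourPoint (hP : IsHalfPlaneCover Ω lam P) (hΩ : IsOpen Ω)
    (hH : ∀ z : ℂ, z.im ≠ 0 → z ∈ Ω) (hconj : ∀ z ∈ Ω, (starRingEnd ℂ) z ∈ Ω)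
    (harc : ∀ z ∈ Ω, ∀ w ∈ Ω, ∃ Γ, IsArc Ω z w Γ) {J : Set ℝ} (hJ : IsOpen J)
    (hJc : J.OrdConnected) (hJn : J.Nonempty) (hJΩ : ∀ x ∈ J, (x : ℂ) ∈ Ω) :
    FourPoint (Ω ∩ {z | 0 ≤ z.im}) (densityDist Ω lam) 26 := by
  have hc := hP.continuousOn_density hΩ
  have hρ := hP.density_nonneg hΩ
  have hd := isPseudoDistOn_densityDist hc hρ harc
  have hUΩ : upperHalf ⊆ Ω := fun z hz => hH z (ne_of_gt hz)
  obtain ⟨c, hcJ⟩ := hJn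
  obtain ⟨s, hs, hsm, hsP, hsl⟩ := hP.exists_section (isOpen_slit hJ)
    (x₀ := c) (Or.inr hcJ) (starConvex_slit hJc hcJ) (slit_subset hH hJΩ)
  have h4 : FourPoint upperHalf (densityDist Ω lam) 18 := by
    have key : ∀ z ∈ upperHalf, ∀ w ∈ upperHalf,
        densityDist Ω lam z w ≤ qhDist upperHalf (s z) (s w) ∧
        qhDist upperHalf (s z) (s w) ≤ densityDist Ω lam z w + 2 := by
      intro z hz w hw
      have hz0 : 0 < z.im := hz
      have hw0 : 0 < w.im := hw
      have hzV : z ∈ {z : ℂ | z.im ≠ 0 ∨ z.re ∈ J} := Or.inl hz0.ne'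
      have hwV : w ∈ {z : ℂ | z.im ≠ 0 ∨ z.re ∈ J} := Or.inl hw0.ne'
      constructor
      · simpa [hsP z hzV, hsP w hwV] using hP.densityDist_le_qhDist hΩ (hsm hzV) (hsm hwV)
      · exact hP.qhDist_section_le hΩ hconj harc (isOpen_slit hJ) (slit_subset hH hJΩ)
          (fun _ => Or.inl) hs hsm hsl (one_pow 2) hzV hwV (by linarith) (by linarith)
    intro x hx y hy z hz w hw
    have hm : ∀ v ∈ upperHalf, s v ∈ upperHalf := fun v hv =>
      hsm (Or.inl (ne_of_gt (show 0 < v.im from hv)))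
    have h := fourPoint_upperHalf _ (hm x hx) _ (hm y hy) _ (hm z hz) _ (hm w hw)
    have n1 := (key x hx z hz).1
    have n2 := (key y hy w hw).1
    have n3 := (key x hx y hy).2
    have n4 := (key z hz w hw).2
    have n5 := (key x hx w hw).2
    have n6 := (key y hy z hz).2
    have m1 := le_max_left (densityDist Ω lam x y + densityDist Ω lam z w)
      (densityDist Ω lam x w + densityDist Ω lam y z)
    have m2 := le_max_right (densityDist Ω lam x y + densityDist Ω lam z w)
      (densityDist Ω lam x w + densityDist Ω lam y z)
    rcases max_choice (qhDist upperHalf (s x) (s y) + qhDist upperHalf (s z) (s w))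
      (qhDist upperHalf (s x) (s w) + qhDist upperHalf (s y) (s z)) with h5 | h5 <;>
      rw [h5] at h <;> linarith
  have h := h4.of_approx (ε := 1) (X := Ω ∩ {z | 0 ≤ z.im}) hd inter_subset_left hUΩ ?_
  · norm_num at h
    exact h
  · rintro x ⟨hx, hx0⟩
    have hx0 : 0 ≤ x.im := hx0
    have hcont : Tendsto (fun ε : ℝ => x + ε * I) (nhdsWithin 0 (Ioi 0)) (nhds x) := by
      have : Continuous fun ε : ℝ => x + ε * I := by fun_prop
      simpa using (this.tendsto 0).mono_left nhdsWithin_le_nhds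
    obtain ⟨ε, hε, hε0⟩ := ((hcont.eventually (eventually_densityDist_le_one hΩ hc hρ hx)).and
      self_mem_nhdsWithin).exists
    refine ⟨x + ε * I, ?_, hε⟩
    have : 0 < ε := hε0
    show 0 < (x + ε * I).im
    simp only [add_im, mul_im, ofReal_re, I_im, ofReal_im, I_re]
    linarith

theorem roughlyJoined (hP : IsHalfPlaneCover Ω lam P) (hΩ : IsOpen Ω)
    (hH : ∀ z : ℂ, z.im ≠ 0 → z ∈ Ω) (hconj : ∀ z ∈ Ω, (starRingEnd ℂ) z ∈ Ω)
    (harc : ∀ z ∈ Ω, ∀ w ∈ Ω, ∃ Γ, IsArc Ω z w Γ) {J : Set ℝ} (hJ : IsOpen J)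
    (hJc : J.OrdConnected) (hJΩ : ∀ x ∈ J, (x : ℂ) ∈ Ω) {p q : ℝ} (hp : p ∈ J) (hq : q ∈ J) :
    RoughlyJoined (Ω ∩ {z | z.im = 0}) (densityDist Ω lam) 21 p q := by
  have hc := hP.continuousOn_density hΩ
  have hρ := hP.density_nonneg hΩ
  have hd := isPseudoDistOn_densityDist hc hρ harc
  obtain ⟨s, hs, hsm, hsP, hsl⟩ := hP.exists_section (isOpen_slit hJ)
    (x₀ := p) (Or.inr hp) (starConvex_slit hJc hp) (slit_subset hH hJΩ)
  have key : ∀ x ∈ J, ∀ v ∈ {z : ℂ | z.im ≠ 0 ∨ z.re ∈ J},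
      qhDist upperHalf (s x) (s v) ≤ densityDist Ω lam x v + 2 := fun x hx v hv => by
    rcases le_total 0 v.im with h | h
    · exact hP.qhDist_section_le hΩ hconj harc (isOpen_slit hJ) (slit_subset hH hJΩ)
        (fun _ => Or.inl) hs hsm hsl (one_pow 2) (Or.inr hx) hv (by simp) (by linarith)
    · exact hP.qhDist_section_le hΩ hconj harc (isOpen_slit hJ) (slit_subset hH hJΩ)
        (fun _ => Or.inl) hs hsm hsl (σ := -1) (by norm_num) (Or.inr hx) hv (by simp)
        (by linarith)
  have key' : ∀ z ∈ {z : ℂ | z.im ≠ 0 ∨ z.re ∈ J}, ∀ w ∈ {z : ℂ | z.im ≠ 0 ∨ z.re ∈ J},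
      densityDist Ω lam z w ≤ qhDist upperHalf (s z) (s w) := fun z hz w hw => by
    simpa [hsP z hz, hsP w hw] using hP.densityDist_le_qhDist hΩ (hsm hz) (hsm hw)
  have hpΩ := hJΩ p hp
  have hqΩ := hJΩ q hq
  intro t h0 h1
  obtain ⟨m, hm, hm1, hm2⟩ := exists_point_at_dist hc hρ (harc _ hpΩ _ hqΩ) h0 h1
  by_cases hm0 : m.im = 0
  · exact ⟨m, ⟨hm, hm0⟩, by linarith, by linarith⟩
  have hmc := hconj m hm
  have hmc0 : ((starRingEnd ℂ) m).im ≠ 0 := by simpa using hm0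
  have hcd : ∀ x ∈ J, densityDist Ω lam x ((starRingEnd ℂ) m) = densityDist Ω lam x m :=
    fun x hx => by
      simpa using densityDist_conj hc hρ harc hconj (fun z hz => hP.density_conj hΩ hconj hz)
        (hJΩ x hx) hm
  have h4 := fourPoint_upperHalf (s p) (hsm (Or.inr hp)) (s m) (hsm (Or.inl hm0)) (s q)
    (hsm (Or.inr hq)) (s ((starRingEnd ℂ) m)) (hsm (Or.inl hmc0))
  have k1 := key p hp m (Or.inl hm0)
  have k2 := key p hp _ (Or.inl hmc0)
  have k3 := key q hq m (Or.inl hm0)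
  have k4 := key q hq _ (Or.inl hmc0)
  have k5 := key' p (Or.inr hp) q (Or.inr hq)
  have k6 := key' m (Or.inl hm0) _ (Or.inl hmc0)
  rw [hcd p hp] at k2
  rw [hcd q hq, ← hd.symm m hm _ hqΩ] at k4
  rw [← hd.symm m hm _ hqΩ, isPseudoDistOn_upperHalf.symm _ (hsm (Or.inr hq)) _
    (hsm (Or.inl hm0))] at k3
  have hmm : densityDist Ω lam m ((starRingEnd ℂ) m) ≤ 19 := by
    rcases max_choice (qhDist upperHalf (s p) (s m) +
      qhDist upperHalf (s q) (s ((starRingEnd ℂ) m)))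
      (qhDist upperHalf (s p) (s ((starRingEnd ℂ) m)) + qhDist upperHalf (s m) (s q))
      with h5 | h5 <;> rw [h5] at h4 <;> linarith
  obtain ⟨c, hcΩ, hc0, hmd⟩ : ∃ c ∈ Ω, c.im = 0 ∧ densityDist Ω lam m c ≤ 20 := by
    rcases le_total 0 m.im with h | h
    · obtain ⟨c, hcΩ, hc0, hcm⟩ := exists_real_crossing hc hρ (harc _ hm _ hmc) h (by simpa using h)
      exact ⟨c, hcΩ, hc0, by linarith [hd.nonneg c hcΩ _ hmc]⟩
    · obtain ⟨c, hcΩ, hc0, hcm⟩ := exists_real_crossing hc hρ (harc _ hmc _ hm)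
        (by simpa using h) h
      rw [hd.symm _ hmc m hm, hd.symm c hcΩ m hm] at hcm
      exact ⟨c, hcΩ, hc0, by linarith [hd.nonneg _ hmc c hcΩ]⟩
  have t1 := hd.triangle _ hpΩ m hm c hcΩ
  have t2 := hd.triangle c hcΩ m hm _ hqΩ
  rw [hd.symm c hcΩ m hm] at t2
  exact ⟨c, ⟨hcΩ, hc0⟩, by linarith, by linarith⟩

end IsHalfPlaneCover

end CoverMetric

section Denjoy

variable {Ω : Set ℂ} {I : ℕ → Set ℝ}

theorem IsDenjoyDomain.mem_of_im_ne_zero (hΩ : IsDenjoyDomain Ω) {c : ℝ} (hc : (c : ℂ) ∈ Ω) {z : ℂ}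
    (hz : z.im ≠ 0) : z ∈ Ω := by
  have key : ∀ H : Set ℂ, Convex ℝ H → (∀ v ∈ H, v.im ≠ 0) → (c : ℂ) ∈ closure H → H ⊆ Ω := by
    intro H hH hne hcl
    obtain ⟨u, huΩ, hu⟩ := mem_closure_iff.1 hcl Ω hΩ.1 hc
    refine hH.isPreconnected.subset_left_of_subset_union hΩ.1 isClosed_closure.isOpen_compl
      (disjoint_compl_right.mono_left subset_closure) (fun v hv => ?_) ⟨u, hu, huΩ⟩
    by_contra hn
    rw [mem_union, not_or, mem_compl_iff, not_not] at hn
    refine hne v hv (hΩ.2.2 ⟨hn.2, ?_⟩)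
    rw [hΩ.1.interior_eq]
    exact hn.1
  have hlim : ∀ σ : ℝ, Tendsto (fun ε : ℝ => (c : ℂ) + (σ * ε : ℝ) * Complex.I)
      (nhdsWithin 0 (Ioi 0)) (nhds c) := fun σ => by
    have : Continuous fun ε : ℝ => (c : ℂ) + (σ * ε : ℝ) * Complex.I := by fun_prop
    simpa using (this.tendsto 0).mono_left nhdsWithin_le_nhds
  rcases lt_or_gt_of_ne hz with h | h
  · refine key {v | v.im < 0} (convex_halfSpace_im_lt 0) (fun v hv => ne_of_lt hv)
      (mem_closure_of_tendsto (hlim (-1)) ?_) h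
    filter_upwards [self_mem_nhdsWithin] with ε hε
    simpa using hε
  · refine key {v | 0 < v.im} (convex_halfSpace_im_gt 0) (fun v hv => ne_of_gt hv)
      (mem_closure_of_tendsto (hlim 1) ?_) h
    filter_upwards [self_mem_nhdsWithin] with ε hε
    simpa using hε

theorem exists_isArc_of_slit {c : ℝ} (hc : (c : ℂ) ∈ Ω) (hH : ∀ z : ℂ, z.im ≠ 0 → z ∈ Ω) :
    ∀ z ∈ Ω, ∀ w ∈ Ω, ∃ Γ, IsArc Ω z w Γ := by
  have trans : ∀ {a b e : ℂ}, (∃ Γ, IsArc Ω a b Γ) → (∃ Γ, IsArc Ω b e Γ) →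
      ∃ Γ, IsArc Ω a e Γ := by
    rintro a b e ⟨Γ, h⟩ ⟨Γ', h'⟩
    obtain ⟨γ, hγ, -⟩ := h.exists_trans (ρ := fun _ => 0) continuousOn_const h'
    exact ⟨γ, hγ⟩
  have vert : ∀ z ∈ Ω, ∀ σ : ℝ, σ ≠ 0 → 0 ≤ σ * z.im → ∃ Γ, IsArc Ω z (z + σ * Complex.I) Γ := by
    intro z hz σ hσ hs
    refine exists_isArc_segment ?_
    rw [segment_eq_image']
    rintro _ ⟨θ, hθ, rfl⟩
    rcases eq_or_lt_of_le hθ.1 with h | h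
    · simpa [← h] using hz
    · refine hH _ fun h0 => ?_
      simp at h0
      have h1 : σ * (z.im + θ * σ) = 0 := by rw [h0, mul_zero]
      nlinarith [mul_pos h (mul_self_pos.2 hσ)]
  have hor : ∀ σ : ℝ, σ ≠ 0 → ∀ z : ℂ, 0 ≤ σ * z.im →
      ∃ Γ, IsArc Ω (z + σ * Complex.I) (c + σ * Complex.I) Γ := by
    intro σ hσ z hs
    refine exists_isArc_segment ?_
    rintro _ ⟨a, b, ha, hb, hab, rfl⟩
    refine hH _ fun h0 => ?_
    simp at h0
    have h1 : σ * (a * z.im + a * σ + b * σ) = 0 := by rw [h0, mul_zero]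
    have h2 : a * (σ * z.im) + (a + b) * (σ * σ) = 0 := by linarith
    rw [hab] at h2
    nlinarith [mul_nonneg ha hs, mul_self_pos.2 hσ]
  have base : ∀ z ∈ Ω, ∃ Γ, IsArc Ω z c Γ := by
    intro z hz
    obtain ⟨σ, hσ, hs⟩ : ∃ σ : ℝ, σ ≠ 0 ∧ 0 ≤ σ * z.im := by
      rcases le_total 0 z.im with h | h
      · exact ⟨1, one_ne_zero, by linarith⟩
      · exact ⟨-1, by norm_num, by linarith⟩
    obtain ⟨Γ, hΓ⟩ := vert c hc σ hσ (by simp)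
    exact trans (trans (vert z hz σ hσ hs) (hor σ hσ z hs)) ⟨_, hΓ.symm⟩
  intro z hz w hw
  obtain ⟨Γ, hΓ⟩ := base w hw
  exact trans (base z hz) ⟨_, hΓ.symm⟩

theorem nonempty_compl_of_pairwise_disjoint (hI : ∀ n, (I n).Nonempty ∧ IsOpen (I n))
    (hdis : Pairwise (Function.onFun Disjoint I))
    (hΩ : (fun x : ℝ => (x : ℂ)) ⁻¹' Ω = ⋃ n, I n) : Ωᶜ.Nonempty := by
  rw [nonempty_compl]
  rintro rfl
  have hcl : IsClopen (I 0) := by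
    refine ⟨⟨?_⟩, (hI 0).2⟩
    have e : (I 0)ᶜ = ⋃ n : {n : ℕ // n ≠ 0}, I n := by
      ext x
      have hx : x ∈ ⋃ n, I n := hΩ ▸ mem_univ _
      obtain ⟨n, hn⟩ := mem_iUnion.1 hx
      simp only [mem_compl_iff, mem_iUnion, Subtype.exists, exists_prop]
      refine ⟨fun h => ⟨n, ?_, hn⟩, ?_⟩
      · rintro rfl
        exact h hn
      · rintro ⟨m, hm, hxm⟩ h
        exact (hdis hm).ne_of_mem hxm h rfl
    rw [e]
    exact isOpen_iUnion fun n => (hI n).2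
  obtain ⟨x, hx⟩ := (hI 1).1
  have h0 : x ∈ I 0 := by
    rw [hcl.eq_univ (hI 0).1]
    trivial
  exact (hdis one_ne_zero).ne_of_mem hx h0 rfl

theorem infDist_conj {E : Set ℂ} (hE : ∀ e ∈ E, e.im = 0) (z : ℂ) :
    infDist ((starRingEnd ℂ) z) E = infDist z E := by
  have key : ∀ e ∈ E, dist ((starRingEnd ℂ) z) e = dist z e := fun e he => by
    rw [← Complex.dist_conj_conj, Complex.conj_conj, Complex.conj_eq_iff_im.2 (hE e he)]
  rw [infDist_eq_iInf, infDist_eq_iInf]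
  exact iInf_congr fun e => key e e.2

theorem gromovHyperbolicWith_of_fundGeodesics {ρ : ℂ → ℝ} (hc : ContinuousOn ρ Ω)
    (hρ : ∀ z ∈ Ω, 0 ≤ ρ z) (harc : ∀ z ∈ Ω, ∀ w ∈ Ω, ∃ Γ, IsArc Ω z w Γ)
    (hconj : ∀ z ∈ Ω, (starRingEnd ℂ) z ∈ Ω) (hρc : ∀ z ∈ Ω, ρ ((starRingEnd ℂ) z) = ρ z)
    (hI0 : (I 0).Nonempty) (hΩI : (fun x : ℝ => (x : ℂ)) ⁻¹' Ω = ⋃ n, I n) {δ K C : ℝ}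
    (hδ : 0 ≤ δ) (hK : 0 ≤ K) (h4 : FourPoint (Ω ∩ {z | 0 ≤ z.im}) (densityDist Ω ρ) δ)
    (hj : ∀ n, ∀ p ∈ I n, ∀ q ∈ I n,
      RoughlyJoined (Ω ∩ {z | z.im = 0}) (densityDist Ω ρ) K p q)
    (hC : ∀ n : ℕ, 1 ≤ n → ∃ x ∈ I 0, ∃ y ∈ I n, densityDist Ω ρ x y ≤ C) :
    GromovHyperbolicWith Ω (densityDist Ω ρ) (32 * C + 32 * K + 134 * δ + 56) := by
  have hd := isPseudoDistOn_densityDist hc hρ harc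
  set d := densityDist Ω ρ
  set A := Ω ∩ {z : ℂ | z.im = 0} with hA
  set X := Ω ∩ {z : ℂ | 0 ≤ z.im} with hX
  have hmem : ∀ n, ∀ p ∈ I n, (p : ℂ) ∈ A := fun n p hp =>
    ⟨hΩI.ge (mem_iUnion.2 ⟨n, hp⟩), ofReal_im p⟩
  have hAX : A ⊆ X := fun a ha => ⟨ha.1, (show a.im = 0 from ha.2).ge⟩
  have hdA : IsPseudoDistOn A d := hd.mono inter_subset_left
  have h4A : FourPoint A d δ := fun x hx y hy z hz w hw =>
    h4 x (hAX hx) y (hAX hy) z (hAX hz) w (hAX hw)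
  obtain ⟨b, hb⟩ := hI0
  have hC0 : 0 ≤ C := by
    obtain ⟨x, -, y, -, h⟩ := hC 1 le_rfl
    exact (densityDist_nonneg hρ).trans h
  have hbase : ∀ a ∈ A, RoughlyJoined A d (C + K + 2 * δ) a b := by
    intro a ha
    have e : a = (a.re : ℂ) := Complex.ext (by simp) (by simpa using ha.2)
    obtain ⟨n, hn⟩ := mem_iUnion.1 (hΩI.le (show (a.re : ℂ) ∈ Ω from e ▸ ha.1))
    rw [e] at ha ⊢
    rcases n.eq_zero_or_pos with rfl | hn0
    · exact (hj 0 _ hn b hb).mono (by linarith)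
    · obtain ⟨x, hx, y, hy, hxy⟩ := hC n hn0
      have hxA := hmem 0 x hx
      have hyA := hmem n y hy
      rw [hdA.symm _ hxA _ hyA] at hxy
      have j1 := (hj n _ hn y hy).mono (show K ≤ C + K by linarith)
      have j2 := (roughlyJoined_of_dist_le hdA hyA hxy).mono (show C ≤ C + K by linarith)
      have j3 := (hj 0 x hx b hb).mono (show K ≤ C + K + δ by linarith)
      exact ((j1.trans hdA hδ h4A ha hyA hxA j2).trans hdA hδ h4A ha hxA (hmem 0 b hb)
        j3).mono (by linarith)
  have hjoin : ∀ p ∈ A, ∀ q ∈ A, RoughlyJoined A d (C + K + 3 * δ) p q := fun p hp q hq =>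
    ((hbase p hp).trans hdA hδ h4A hp (hmem 0 b hb) hq
      ((hbase q hq).symm hdA hq (hmem 0 b hb))).mono (by linarith)
  have hproj := fun x (hx : x ∈ X) => h4.exists_projection (hd.mono inter_subset_left) hδ
    (show 0 ≤ C + K + 3 * δ by positivity) hAX ⟨b, hmem 0 b hb⟩ hjoin hx
  have h := FourPoint.double hd (σ := starRingEnd ℂ) hconj
    (fun x hx y hy => densityDist_conj hc hρ harc hconj hρc hx hy) (fun x _ => Complex.conj_conj x)
    (inter_subset_left : X ⊆ Ω) hAX (fun a ha => Complex.conj_eq_iff_im.2 ha.2)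
    (fun x hx => (le_total 0 x.im).imp (fun h => ⟨hx, h⟩)
      fun h => ⟨hconj x hx, by simpa using h⟩)
    (fun x hx y hy => by
      obtain ⟨q, hq, hq0, h⟩ := exists_real_crossing hc hρ (harc x hx.1 _ (hconj y hy.1)) hx.2
        (by simpa using hy.2)
      exact ⟨q, ⟨hq, hq0⟩, h⟩)
    hδ (by positivity) h4 hproj
  convert h.gromovHyperbolicWith hd (by positivity) using 1
  ring

end Denjoy

noncomputable section

/-- Corollary 3.4: if some sequence of fundamental geodesics has `κ_Ω`-length bounded by `C`,
then `κ_Ω` (either the Poincaré or the quasihyperbolic metric) is Gromov `δ`-hyperbolic with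
`δ` depending only on `C`. (The `κ_Ω`-length of a geodesic equals the distance between its
endpoints.) -/
theorem denjoy_hyperbolic_of_short_fund_geodesics :
    ∃ F : ℝ → ℝ,
      ∀ (Ω : Set ℂ) (I : ℕ → Set ℝ) (d : ℂ → ℂ → ℝ),
        IsDenjoyDomain Ω →
        (∀ n, (I n).Nonempty ∧ IsOpen (I n) ∧ (I n).OrdConnected) →
        Pairwise (Function.onFun Disjoint I) →
        (fun x : ℝ => (x : ℂ)) ⁻¹' Ω = (⋃ n, I n) →
        (d = qhDist Ω ∨ ∃ lam : ℂ → ℝ, IsPoincareDensity Ω lam ∧ d = densityDist Ω lam) →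
        ∀ C : ℝ,
          (∃ (g : ℕ → ℝ → ℂ) (x y : ℕ → ℂ), ∀ n : ℕ, 1 ≤ n →
            IsFundGeodesic Ω d (I 0) (I n) (g n) (x n) (y n) ∧ d (x n) (y n) ≤ C) →
          GromovHyperbolicWith Ω d (F C) := by
  refine ⟨fun C => 32 * C + 32 * 21 + 134 * 26 + 56, ?_⟩
  rintro Ω I d hΩ hI hdis hΩI hd C ⟨g, x, y, hg⟩
  have hIΩ : ∀ n, ∀ u ∈ I n, (u : ℂ) ∈ Ω := fun n u hu => hΩI.ge (mem_iUnion.2 ⟨n, hu⟩)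
  obtain ⟨c, hc⟩ := (hI 0).1
  have hH : ∀ z : ℂ, z.im ≠ 0 → z ∈ Ω := fun z => hΩ.mem_of_im_ne_zero (hIΩ 0 c hc)
  have hE : ∀ e ∈ Ωᶜ, e.im = 0 := fun e he => not_not.1 fun h => he (hH e h)
  have harc := exists_isArc_of_slit (hIΩ 0 c hc) hH
  have hconj : ∀ z ∈ Ω, (starRingEnd ℂ) z ∈ Ω := fun z hz => by
    by_cases h : z.im = 0
    · rwa [Complex.conj_eq_iff_im.2 h]
    · exact hH _ (by simpa using h)
  have hne := nonempty_compl_of_pairwise_disjoint (fun n => ⟨(hI n).1, (hI n).2.1⟩) hdis hΩI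
  have hC : ∀ n : ℕ, 1 ≤ n → ∃ x ∈ I 0, ∃ y ∈ I n, d x y ≤ C := fun n hn => by
    obtain ⟨⟨-, hx0, hx, hy0, hy, -⟩, h⟩ := hg n hn
    refine ⟨_, hx, _, hy, ?_⟩
    convert h using 2 <;> apply Complex.ext <;> simp [hx0, hy0]
  rcases hd with rfl | ⟨lam, hlam, rfl⟩
  · refine gromovHyperbolicWith_of_fundGeodesics (continuousOn_qhDensity hΩ.1 hne)
      qhDensity_nonneg harc hconj (fun z _ => congr_arg Inv.inv (infDist_conj hE z)) (hI 0).1 hΩI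
      (by norm_num) (by norm_num) ?_ ?_ hC
    · have h26 : (14 : ℝ) ≤ 26 := by norm_num
      exact fun x hx y hy z hz w hw => (fourPoint_qhDist hΩ.1 hne (fun e he => (hE e he).le) harc
        x hx y hy z hz w hw).trans (add_le_add le_rfl h26)
    · intro n p hp q hq
      have hp' : (p : ℂ) ∈ Ω ∩ {z | z.im = 0} := ⟨hIΩ n p hp, ofReal_im p⟩
      have hq' : (q : ℂ) ∈ Ω ∩ {z | z.im = 0} := ⟨hIΩ n q hq, ofReal_im q⟩
      rcases le_total p q with h | h
      · exact (roughlyJoined_qhDist hΩ.1 hne hE harc h fun u hu =>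
          hIΩ n u ((hI n).2.2.out hp hq hu)).mono (by norm_num)
      · exact ((roughlyJoined_qhDist hΩ.1 hne hE harc h fun u hu =>
          hIΩ n u ((hI n).2.2.out hq hp hu)).symm
          ((isPseudoDistOn_densityDist (continuousOn_qhDensity hΩ.1 hne) qhDensity_nonneg
            harc).mono inter_subset_left) hq' hp').mono (by norm_num)
  · obtain ⟨P, hP⟩ := hlam.exists_isHalfPlaneCover
    exact gromovHyperbolicWith_of_fundGeodesics (hP.continuousOn_density hΩ.1)
      (hP.density_nonneg hΩ.1) harc hconj (fun z hz => hP.density_conj hΩ.1 hconj hz)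
      (hI 0).1 hΩI (by norm_num) (by norm_num)
      (hP.fourPoint hΩ.1 hH hconj harc (hI 0).2.1 (hI 0).2.2 (hI 0).1 (hIΩ 0))
      (fun n p hp q hq =>
        hP.roughlyJoined hΩ.1 hH hconj harc (hI n).2.1 (hI n).2.2 (hIΩ n) hp hq) hC

end
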